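/- (Fundamental gap theorem of Andrews–Clutterbuck.) Let Ω ⊂ ℝⁿ be a bounded open set with C² boundary whose second fundamental form with respect to the outward normal is positive definite (strictly convex), with diameter D, and let q be a convex function, C¹ on the closure of Ω. Let φ₀ be a first Dirichlet eigenfunction of L_q = Δ − q with eigenvalue λ₀, and let φ₁ be a second eigenfunction: φ₁ is C² on the closure of Ω, vanishes on ∂Ω, is not identically zero, satisfies Δφ₁ − qφ₁ = −λ₁φ₁ in Ω for a real number λ₁, and the quotient w = φ₁/φ₀ extends to a nonconstant C² function on the closure of Ω whose outward normal derivative ∂w/∂ν vanishes on ∂Ω. Then λ₁ − λ₀ ≥ 3π²/D². -/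

import Mathlib

open scoped RealInnerProductSpace
open Set MeasureTheory

noncomputable def lap {n : ℕ} (f : EuclideanSpace ℝ (Fin n) → ℝ) (x : EuclideanSpace ℝ (Fin n)) : ℝ :=
  ∑ i, fderiv ℝ (fun y => fderiv ℝ f y (EuclideanSpace.single i 1)) x
      (EuclideanSpace.single i 1)


section
set_option linter.unusedSectionVars false
set_option maxSynthPendingDepth 3
open Filter Topology
variable {F : Type*} [NormedAddCommGroup F] [InnerProductSpace ℝ F] [FiniteDimensional ℝ F]

structure Geo (Ω : Set F) (ρ : F → ℝ) : Prop where
  isOpen : IsOpen Ω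
  bdd : Bornology.IsBounded Ω
  cd : ContDiff ℝ 2 ρ
  eqq : Ω = {x | ρ x < 0}
  fr : frontier Ω = {x | ρ x = 0}
  ne : ∀ x ∈ frontier Ω, gradient ρ x ≠ 0
  sc : ∀ x ∈ frontier Ω, ∀ v : F, v ≠ 0 → fderiv ℝ ρ x v = 0 →
      0 < fderiv ℝ (fderiv ℝ ρ) x v v
  conv : Convex ℝ (closure Ω)

structure TwoD (K : Set F) (f : F → ℝ) (f1 : F → F →L[ℝ] ℝ) (f2 : F → F →L[ℝ] F →L[ℝ] ℝ) :
    Prop where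
  d1 : ∀ x ∈ K, HasFDerivWithinAt f (f1 x) K x
  d2 : ∀ x ∈ K, HasFDerivWithinAt f1 (f2 x) K x
  c2 : ContinuousOn f2 K

lemma second_deriv_nonpos_right {F F' : ℝ → ℝ} {A : ℝ}
    (h1 : ∀ᶠ t in 𝓝 (0:ℝ), HasDerivAt F (F' t) t) (h2 : HasDerivAt F' A 0) (h0 : F' 0 = 0)
    (hm : ∀ᶠ t in 𝓝[>] (0:ℝ), F t ≤ F 0) : A ≤ 0 := by
  by_contra hA
  push Not at hA
  have hpos : ∀ᶠ t in 𝓝[>] (0:ℝ), 0 < F' t := by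
    have := (hasDerivAt_iff_tendsto_slope.1 h2).eventually (lt_mem_nhds hA)
    have h3 : ∀ᶠ t in 𝓝[>] (0:ℝ), 0 < slope F' 0 t :=
      this.filter_mono (nhdsWithin_mono _ (fun t ht => ne_of_gt ht))
    filter_upwards [h3, self_mem_nhdsWithin] with t ht ht0
    rw [slope_def_field, h0] at ht
    have ht0' : (0:ℝ) < t := ht0
    rw [sub_zero, sub_zero] at ht
    exact (div_pos_iff_of_pos_right ht0').1 ht
  have hall : ∀ᶠ t in 𝓝[>] (0:ℝ), 0 < F' t ∧ HasDerivAt F (F' t) t ∧ F t ≤ F 0 :=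
    hpos.and ((h1.filter_mono nhdsWithin_le_nhds).and hm)
  obtain ⟨ε, hε, hsub⟩ := mem_nhdsGT_iff_exists_Ioc_subset.1 hall
  have hε' : (0:ℝ) < ε := hε
  have hd : ∀ t ∈ Icc (0:ℝ) ε, HasDerivAt F (F' t) t := by
    intro t ht
    rcases eq_or_lt_of_le ht.1 with h | h
    · rw [← h]; exact h1.self_of_nhds
    · exact (hsub ⟨h, ht.2⟩).2.1
  have hmono : StrictMonoOn F (Icc 0 ε) := by
    apply strictMonoOn_of_deriv_pos (convex_Icc 0 ε)
    · exact fun t ht => (hd t ht).continuousAt.continuousWithinAt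
    · intro t ht
      rw [interior_Icc] at ht
      rw [(hd t ⟨ht.1.le, ht.2.le⟩).deriv]
      exact (hsub ⟨ht.1, ht.2.le⟩).1
  have := hmono (left_mem_Icc.2 hε'.le) (right_mem_Icc.2 hε'.le) hε'
  exact absurd (hsub ⟨hε', le_refl _⟩).2.2 (not_le.2 this)

lemma second_deriv_nonpos {F F' : ℝ → ℝ} {A : ℝ}
    (h1 : ∀ᶠ t in 𝓝 (0:ℝ), HasDerivAt F (F' t) t) (h2 : HasDerivAt F' A 0)
    (hm : IsLocalMax F 0) : A ≤ 0 :=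
  second_deriv_nonpos_right h1 h2 (hm.hasDerivAt_eq_zero h1.self_of_nhds)
    (hm.filter_mono nhdsWithin_le_nhds)

lemma hasDerivAt_line (x v : F) (t : ℝ) : HasDerivAt (fun s : ℝ => x + s • v) v t := by
  simpa using ((hasDerivAt_id t).smul_const v).const_add x

namespace Geo
variable {Ω : Set F} {ρ : F → ℝ}

lemma closure_eq (g : Geo Ω ρ) : closure Ω = {x | ρ x ≤ 0} := by
  rw [closure_eq_self_union_frontier, g.fr]
  conv_lhs => rw [g.eqq]
  ext x
  simp [le_iff_lt_or_eq]

lemma diff (g : Geo Ω ρ) : Differentiable ℝ ρ := g.cd.differentiable (by norm_num)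

lemma diff2 (g : Geo Ω ρ) : Differentiable ℝ (fderiv ℝ ρ) :=
  (g.cd.fderiv_right (m := 1) (by norm_num)).differentiable (by norm_num)

lemma cont2 (g : Geo Ω ρ) : Continuous (fderiv ℝ (fderiv ℝ ρ)) :=
  (g.cd.fderiv_right (m := 1) (by norm_num)).continuous_fderiv (by norm_num)

lemma closed_mem (g : Geo Ω ρ) {x : F} (hx : x ∈ frontier Ω) : x ∈ closure Ω := frontier_subset_closure hx

lemma interior_eq (g : Geo Ω ρ) : interior (closure Ω) = Ω := by
  apply Subset.antisymm _ (g.isOpen.subset_interior_closure)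
  intro z hz
  by_contra hzΩ
  have hzf : z ∈ frontier Ω := by
    rw [g.isOpen.frontier_eq]
    exact ⟨interior_subset hz, hzΩ⟩
  have h0 : ρ z = 0 := by
    have := hzf; rw [g.fr] at this; exact this
  have hmax : IsLocalMax ρ z := by
    filter_upwards [mem_interior_iff_mem_nhds.1 hz] with y hy
    rw [g.closure_eq] at hy
    rw [h0]; exact hy
  apply g.ne z hzf
  have h1 := hmax.fderiv_eq_zero
  unfold gradient
  rw [h1, map_zero]

lemma convΩ (g : Geo Ω ρ) : Convex ℝ Ω := by
  rw [← g.interior_eq]; exact g.conv.interior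

lemma mem_or (g : Geo Ω ρ) {x : F} (hx : x ∈ closure Ω) : x ∈ Ω ∨ x ∈ frontier Ω := by
  rw [closure_eq_self_union_frontier] at hx; exact hx

lemma rho_line (g : Geo Ω ρ) (x v : F) (t : ℝ) :
    HasDerivAt (fun s : ℝ => ρ (x + s • v)) (fderiv ℝ ρ (x + t • v) v) t :=
  (g.diff (x + t • v)).hasFDerivAt.comp_hasDerivAt t (hasDerivAt_line x v t)

/-- strict convexity -/
lemma strict (g : Geo Ω ρ) {x y : F} (hx : x ∈ frontier Ω) (hy : y ∈ closure Ω) (hxy : y ≠ x) :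
    fderiv ℝ ρ x (y - x) < 0 := by
  have hx0 : ρ x = 0 := by have := hx; rw [g.fr] at this; exact this
  have hmax : IsMaxOn ρ (closure Ω) x := by
    intro z hz
    rw [g.closure_eq] at hz
    rw [mem_ofPred_eq, hx0]; exact hz
  have hle : fderiv ℝ ρ x (y - x) ≤ 0 := by
    refine hmax.localize.hasFDerivWithinAt_nonpos (g.diff x).hasFDerivAt.hasFDerivWithinAt ?_
    apply mem_posTangentConeAt_of_segment_subset
    rw [add_sub_cancel]
    exact g.conv.segment_subset (g.closed_mem hx) hy
  refine lt_of_le_of_ne hle fun h0 => ?_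
  have hpos := g.sc x hx (y - x) (sub_ne_zero.2 hxy) h0
  refine absurd hpos (not_lt.2 ?_)
  refine second_deriv_nonpos_right (F := fun t => ρ (x + t • (y - x)))
    (F' := fun t => fderiv ℝ ρ (x + t • (y - x)) (y - x))
    (Eventually.of_forall fun t => g.rho_line x (y - x) t) ?_ ?_ ?_
  · have h2 : HasFDerivAt (fderiv ℝ ρ) (fderiv ℝ (fderiv ℝ ρ) x) (x + (0:ℝ) • (y - x)) := by
      rw [zero_smul, add_zero]
      exact (g.diff2 x).hasFDerivAt
    have := h2.comp_hasDerivAt (0:ℝ) (hasDerivAt_line x (y - x) 0)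
    have h3 := this.clm_apply (hasDerivAt_const (0:ℝ) (y - x))
    simpa using h3
  · simpa using h0
  · filter_upwards [Ioc_mem_nhdsGT (show (0:ℝ) < 1 by norm_num)] with t ht
    simp only [zero_smul, add_zero]
    refine hmax ?_
    have := g.conv.add_smul_sub_mem (g.closed_mem hx) hy ⟨ht.1.le, ht.2⟩
    exact this

lemma inward (g : Geo Ω ρ) {x v : F} (hx : x ∈ frontier Ω) (hv : fderiv ℝ ρ x v < 0) :
    ∀ᶠ t in 𝓝[>] (0:ℝ), x + t • v ∈ Ω := by
  have hx0 : ρ x = 0 := by have := hx; rw [g.fr] at this; exact this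
  have h1 := g.rho_line x v 0
  rw [zero_smul, add_zero] at h1
  have := (hasDerivAt_iff_tendsto_slope.1 h1).eventually (gt_mem_nhds hv)
  have h3 := this.filter_mono (nhdsWithin_mono _ (fun t (ht : t ∈ Ioi (0:ℝ)) => ne_of_gt ht))
  filter_upwards [h3, self_mem_nhdsWithin] with t ht ht0
  rw [slope_def_field] at ht
  have ht0' : (0:ℝ) < t := ht0
  simp only [zero_smul, add_zero, sub_zero, hx0] at ht
  rw [g.eqq]
  exact (div_neg_iff.1 ht).elim (fun h => absurd h.2 (not_lt.2 ht0'.le)) (fun h => h.1)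

lemma inward_tangent (g : Geo Ω ρ) {x v : F} (hx : x ∈ frontier Ω) (hv : fderiv ℝ ρ x v < 0) :
    v ∈ posTangentConeAt (closure Ω) x := by
  apply mem_posTangentConeAt_of_frequently_mem
  exact ((g.inward hx hv).mono fun t ht => subset_closure ht).frequently

lemma rho_grad_pos (g : Geo Ω ρ) {x : F} (hx : x ∈ frontier Ω) : 0 < fderiv ℝ ρ x (gradient ρ x) := by
  rw [← inner_gradient_left, real_inner_self_eq_norm_sq]
  have := norm_pos_iff.2 (g.ne x hx)
  positivity

end Geo
end
section
set_option linter.unusedSectionVars false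
set_option maxSynthPendingDepth 3
open Filter Topology

/-- Third order necessary condition without third derivatives. -/
lemma third_order {F ι : Type*} [NormedAddCommGroup F] [InnerProductSpace ℝ F]
    [FiniteDimensional ℝ F] [Fintype ι] (b : ι → F) (hb : ∀ i, ‖b i‖ = 1) (e : F) (he : ‖e‖ = 1)
    (H k : F → ℝ) (a A : ι → F → ℝ) (L' : F →L[ℝ] ℝ)
    (hk : ∀ᶠ v in 𝓝 (0:F), HasDerivAt (fun t : ℝ => H (v + t • e)) (k v) 0)
    (hH : ∀ᶠ v in 𝓝 (0:F), ContinuousAt H v)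
    (ha : ∀ᶠ v in 𝓝 (0:F), ∀ i, HasDerivAt (fun t : ℝ => H (v + t • b i)) (a i v) 0)
    (hA : ∀ᶠ v in 𝓝 (0:F), ∀ i, HasDerivAt (fun t : ℝ => a i (v + t • b i)) (A i v) 0)
    (hL : HasStrictFDerivAt (fun v => ∑ i, A i v) L' 0)
    (hkc : ContinuousAt k 0)
    (hm : IsLocalMax k 0) : L' e ≤ 0 := by
  by_contra hc0
  push Not at hc0
  obtain ⟨c, hc, hcL⟩ : ∃ c, 0 < c ∧ 2 * c ≤ L' e := ⟨L' e / 2, by linarith, by linarith⟩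
  -- strict differentiability
  have hLs : ∀ᶠ p : F × F in 𝓝 ((0:F), (0:F)),
      ‖(∑ i, A i p.1) - (∑ i, A i p.2) - L' (p.1 - p.2)‖ ≤ c * ‖p.1 - p.2‖ := by
    exact hL.isLittleO.def hc
  obtain ⟨r₁, hr₁, hr₁s⟩ := Metric.eventually_nhds_iff_ball.1 hLs
  obtain ⟨r₂, hr₂, hr₂s⟩ := Metric.eventually_nhds_iff_ball.1
    (hk.and (hH.and (ha.and (hA.and hm))))
  obtain ⟨r, hr, hrr⟩ : ∃ r, 0 < r ∧ 3 * r ≤ min r₁ r₂ :=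
    ⟨min r₁ r₂ / 3, by positivity, by linarith⟩
  have hrr₁ : 3 * r ≤ r₁ := hrr.trans (min_le_left _ _)
  have hrr₂ : 3 * r ≤ r₂ := hrr.trans (min_le_right _ _)
  -- kappa
  obtain ⟨κ, hκ, hκc⟩ : ∃ κ : ℝ, 0 < κ ∧ 2 * (Fintype.card ι : ℝ) * κ < c := by
    refine ⟨c / (2 * (Fintype.card ι : ℝ) + 1), by positivity, ?_⟩
    rw [← mul_div_assoc, div_lt_iff₀ (by positivity)]
    nlinarith
  -- continuity of k
  have hkcont : ∀ᶠ v in 𝓝 (0:F), k 0 - κ * r ^ 2 < k v :=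
    hkc.eventually (lt_mem_nhds (by have : 0 < κ * r ^ 2 := by positivity
                                    linarith))
  obtain ⟨r₃, hr₃, hr₃s⟩ := Metric.eventually_nhds_iff_ball.1 hkcont
  obtain ⟨h, hh, hhr, hhr₃⟩ : ∃ h, 0 < h ∧ h ≤ r ∧ h < r₃ :=
    ⟨min r (r₃ / 2), by positivity, min_le_left _ _, (min_le_right _ _).trans_lt (by linarith)⟩
  -- MVT
  have mvt : ∀ v : F, ‖v‖ ≤ r → ∃ θ ∈ Ioo 0 h, H (v + h • e) - H v = h * k (v + θ • e) := by
    intro v hv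
    have hd : ∀ s ∈ Icc (0:ℝ) h, HasDerivAt (fun s : ℝ => H (v + s • e)) (k (v + s • e)) s := by
      intro s hs
      have hmem : v + s • e ∈ Metric.ball (0:F) r₂ := by
        rw [mem_ball_zero_iff]
        calc ‖v + s • e‖ ≤ ‖v‖ + ‖s • e‖ := norm_add_le _ _
          _ ≤ r + r := by
            rw [norm_smul, he, mul_one, Real.norm_of_nonneg hs.1]
            linarith [hs.2]
          _ < r₂ := by linarith
      have h1 := (hr₂s _ hmem).1
      have h2 := HasDerivAt.comp s (h := fun s' : ℝ => s' - s) (h₂ := fun t : ℝ => H (v + s • e + t • e))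
        (h₂' := k (v + s • e)) (by simpa using h1) ((hasDerivAt_id s).sub_const s)
      rw [mul_one] at h2
      refine h2.congr_of_eventuallyEq (Eventually.of_forall fun t => ?_)
      simp only [Function.comp]
      congr 1
      module
    obtain ⟨θ, hθ, hθe⟩ := exists_hasDerivAt_eq_slope (fun s : ℝ => H (v + s • e))
      (fun s => k (v + s • e)) hh
      (fun s hs => (hd s hs).continuousAt.continuousWithinAt)
      (fun s hs => hd s ⟨hs.1.le, hs.2.le⟩)
    refine ⟨θ, hθ, ?_⟩
    rw [hθe]
    simp
    field_simp
  -- the maximum of M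
  set M : F → ℝ := fun v => H (v + h • e) - H v - h * κ * ‖v‖ ^ 2 with hM
  have hmemr : ∀ v : F, ‖v‖ ≤ r → v ∈ Metric.ball (0:F) r₂ ∧ v + h • e ∈ Metric.ball (0:F) r₂ := by
    intro v hv
    constructor
    · rw [mem_ball_zero_iff]; linarith
    · rw [mem_ball_zero_iff]
      calc ‖v + h • e‖ ≤ ‖v‖ + ‖h • e‖ := norm_add_le _ _
        _ ≤ r + r := by
          rw [norm_smul, he, mul_one, Real.norm_of_nonneg hh.le]
          linarith
        _ < r₂ := by linarith
  have hMc : ContinuousOn M (Metric.closedBall 0 r) := by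
    intro v hv
    have hv' : ‖v‖ ≤ r := by simpa using hv
    have h1 : ContinuousAt H v := (hr₂s _ (hmemr v hv').1).2.1
    have h2 : ContinuousAt (fun v => H (v + h • e)) v := by
      have h3 : ContinuousAt H (v + h • e) := (hr₂s _ (hmemr v hv').2).2.1
      exact ContinuousAt.comp (f := fun v : F => v + h • e) h3 (by fun_prop)
    apply ContinuousAt.continuousWithinAt
    exact (h2.sub h1).sub (by fun_prop)
  obtain ⟨v, hv, hvmax⟩ := (isCompact_closedBall (0:F) r).exists_isMaxOn ⟨0, by simp [hr.le]⟩ hMc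
  have hv' : ‖v‖ ≤ r := by simpa using hv
  rcases eq_or_lt_of_le hv' with hvr | hvr
  · -- boundary
    have h0 := hvmax (show (0:F) ∈ Metric.closedBall 0 r by simp [hr.le])
    obtain ⟨θ, hθ, hθe⟩ := mvt v hv'
    obtain ⟨θ', hθ', hθe'⟩ := mvt 0 (by simp [hr.le])
    simp only [hM, mem_ofPred_eq] at h0
    rw [hθe, hθe', hvr, norm_zero] at h0
    have hk1 : k (v + θ • e) ≤ k 0 := by
      refine (hr₂s _ ?_).2.2.2.2
      rw [mem_ball_zero_iff]
      calc ‖v + θ • e‖ ≤ ‖v‖ + ‖θ • e‖ := norm_add_le _ _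
        _ ≤ r + r := by
          rw [norm_smul, he, mul_one, Real.norm_of_nonneg hθ.1.le]
          linarith [hθ.2]
        _ < r₂ := by linarith
    have hk2 := hr₃s (0 + θ' • e) (by
      rw [mem_ball_zero_iff, zero_add, norm_smul, he, mul_one, Real.norm_of_nonneg hθ'.1.le]
      linarith [hθ'.2])
    have : k (0 + θ' • e) ≤ k (v + θ • e) - κ * r ^ 2 := by
      have : h * k (0 + θ' • e) ≤ h * (k (v + θ • e) - κ * r ^ 2) := by nlinarith
      exact le_of_mul_le_mul_left this hh
    linarith
  · -- interior
    have hloc : IsLocalMax M v := by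
      refine hvmax.isLocalMax ?_
      exact mem_of_superset (Metric.isOpen_ball.mem_nhds (by simpa using hvr)) Metric.ball_subset_closedBall
    have hi : ∀ i, A i (v + h • e) - A i v - h * κ * 2 ≤ 0 := by
      intro i
      have hlin : ∀ w : F, Tendsto (fun t : ℝ => w + t • b i) (𝓝 0) (𝓝 w) := by
        intro w
        have : Continuous (fun t : ℝ => w + t • b i) := by fun_prop
        simpa using this.tendsto 0
      have key : ∀ w ∈ Metric.ball (0:F) r₂, ∀ᶠ t in 𝓝 (0:ℝ),
          HasDerivAt (fun t : ℝ => H (w + t • b i)) (a i (w + t • b i)) t := by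
        intro w hw
        filter_upwards [(hlin w).eventually (Metric.isOpen_ball.mem_nhds hw)] with s hs
        have h1 := (hr₂s _ hs).2.2.1 i
        have h2 := HasDerivAt.comp s (h := fun s' : ℝ => s' - s) (h₂ := fun t : ℝ => H (w + s • b i + t • b i))
          (h₂' := a i (w + s • b i)) (by simpa using h1) ((hasDerivAt_id s).sub_const s)
        rw [mul_one] at h2
        refine h2.congr_of_eventuallyEq (Eventually.of_forall fun t => ?_)
        simp only [Function.comp]
        congr 1
        module
      have hnorm : ∀ t : ℝ, ‖v + t • b i‖ ^ 2 = ‖v‖ ^ 2 + 2 * t * ⟪v, b i⟫ + t ^ 2 := by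
        intro t
        rw [norm_add_sq_real, norm_smul, hb i, inner_smul_right, mul_one, Real.norm_eq_abs, sq_abs]
        ring
      refine second_deriv_nonpos (F := fun t => M (v + t • b i))
        (F' := fun t => a i (v + h • e + t • b i) - a i (v + t • b i)
          - h * κ * (2 * ⟪v, b i⟫ + 2 * t)) ?_ ?_ ?_
      · filter_upwards [key v (hmemr v hv').1, key _ (hmemr v hv').2] with t ht1 ht2
        have e1 : (fun t : ℝ => M (v + t • b i)) = fun t => H (v + h • e + t • b i) - H (v + t • b i)
            - h * κ * (‖v‖ ^ 2 + 2 * t * ⟪v, b i⟫ + t ^ 2) := by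
          funext t
          simp only [hM]
          rw [hnorm, add_right_comm]
        rw [e1]
        refine (ht2.sub ht1).sub (HasDerivAt.const_mul _ ?_)
        have := ((((hasDerivAt_id t).const_mul 2).mul_const ⟪v, b i⟫).const_add (‖v‖ ^ 2)).add ((hasDerivAt_id t).pow 2)
        refine HasDerivAt.congr_deriv (this.congr_of_eventuallyEq (Eventually.of_forall fun s => ?_)) ?_
        · simp
        · simp
      · have h1 := (hr₂s _ (hmemr v hv').1).2.2.2.1 i
        have h2 := (hr₂s _ (hmemr v hv').2).2.2.2.1 i
        refine (h2.sub h1).sub (HasDerivAt.const_mul _ ?_)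
        have := ((hasDerivAt_id (0:ℝ)).const_mul 2).const_add (2 * ⟪v, b i⟫)
        simpa using this
      · have := hlin v
        have h3 : IsLocalMax M (v + (0:ℝ) • b i) := by simpa using hloc
        exact h3.comp_continuous (g := fun t : ℝ => v + t • b i) (by fun_prop)
    have hsum := Finset.sum_le_sum (s := Finset.univ) (fun i _ => hi i)
    simp only [Finset.sum_sub_distrib, Finset.sum_const_zero, Finset.sum_const, Finset.card_univ, nsmul_eq_mul] at hsum
    have hst := hr₁s (v + h • e, v) (by
      rw [Metric.mem_ball, Prod.dist_eq, dist_zero_right, dist_zero_right, max_lt_iff]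
      refine ⟨?_, by simp only; linarith⟩
      calc ‖v + h • e‖ ≤ ‖v‖ + ‖h • e‖ := norm_add_le _ _
        _ ≤ r + r := by
          rw [norm_smul, he, mul_one, Real.norm_of_nonneg hh.le]
          linarith
        _ < r₁ := by linarith)
    simp only [add_sub_cancel_left, map_smul, smul_eq_mul, norm_smul, he, mul_one, Real.norm_of_nonneg hh.le] at hst
    have := (abs_le.1 (Real.norm_eq_abs _ ▸ hst)).1
    nlinarith
end

section
set_option linter.unusedSectionVars false
set_option maxSynthPendingDepth 3
open Filter Topology
variable {F : Type*} [NormedAddCommGroup F] [InnerProductSpace ℝ F] [FiniteDimensional ℝ F]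

lemma line_within {G : Type*} [NormedAddCommGroup G] [NormedSpace ℝ G] {K : Set F}
    (hc : Convex ℝ K) {x u : F} (hx : x ∈ K) {t₀ : ℝ} (ht₀ : 0 ≤ t₀)
    (hxu : x + t₀ • u ∈ K) {f : F → G} {f1 : F → F →L[ℝ] G}
    (hf : ∀ z ∈ K, HasFDerivWithinAt f (f1 z) K z) {s : ℝ} (hs : s ∈ Icc 0 t₀) :
    x + s • u ∈ K ∧ HasDerivWithinAt (fun t : ℝ => f (x + t • u)) (f1 (x + s • u) u) (Icc 0 t₀) s := by
  have hmem : ∀ s ∈ Icc 0 t₀, x + s • u ∈ K := by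
    intro s hs
    rcases eq_or_lt_of_le ht₀ with h | h
    · have : s = 0 := le_antisymm (h ▸ hs.2) hs.1
      simpa [this] using hx
    · have := hc.add_smul_mem hx hxu (t := s / t₀) ⟨div_nonneg hs.1 ht₀, (div_le_one h).2 hs.2⟩
      rwa [smul_smul, div_mul_cancel₀ _ h.ne'] at this
  refine ⟨hmem s hs, ?_⟩
  exact (hf _ (hmem s hs)).comp_hasDerivWithinAt s (hasDerivAt_line x u s).hasDerivWithinAt
    (fun t ht => hmem t ht)

namespace Geo
variable {Ω : Set F} {ρ : F → ℝ} {φ : F → ℝ} {P : F → F →L[ℝ] ℝ} {Q : F → F →L[ℝ] F →L[ℝ] ℝ}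

lemma P_tangent (g : Geo Ω ρ) (h : TwoD (closure Ω) φ P Q) (hpos : ∀ x ∈ Ω, 0 < φ x)
    (hbd : ∀ x ∈ frontier Ω, φ x = 0) {x : F} (hx : x ∈ frontier Ω) {v : F}
    (hv : fderiv ℝ ρ x v = 0) : P x v = 0 := by
  have hmin : IsMinOn φ (closure Ω) x := by
    intro z hz
    rw [mem_ofPred_eq, hbd x hx]
    rcases g.mem_or hz with h | h
    · exact (hpos z h).le
    · exact (hbd z h).ge
  have key : ∀ u : F, fderiv ℝ ρ x u < 0 → 0 ≤ P x u := fun u hu =>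
    hmin.localize.hasFDerivWithinAt_nonneg (h.d1 x (g.closed_mem hx)) (g.inward_tangent hx hu)
  have key2 : ∀ u : F, fderiv ℝ ρ x u = 0 → 0 ≤ P x u := by
    intro u hu
    have hG := g.rho_grad_pos hx
    have h1 : ∀ᶠ δ in 𝓝[>] (0:ℝ), 0 ≤ P x u - δ * P x (gradient ρ x) := by
      filter_upwards [self_mem_nhdsWithin] with δ hδ
      have hδ' : (0:ℝ) < δ := hδ
      have := key (u - δ • gradient ρ x) (by
        rw [map_sub, map_smul, hu, smul_eq_mul]
        nlinarith)
      simpa using this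
    have h2 : Tendsto (fun δ : ℝ => P x u - δ * P x (gradient ρ x)) (𝓝[>] 0) (𝓝 (P x u)) := by
      have : Continuous (fun δ : ℝ => P x u - δ * P x (gradient ρ x)) := by fun_prop
      have := this.tendsto 0
      simp only [zero_mul, sub_zero] at this
      exact this.mono_left nhdsWithin_le_nhds
    exact ge_of_tendsto h2 h1
  have h1 := key2 v hv
  have h2 := key2 (-v) (by simp [hv])
  simp at h2
  linarith

lemma P_eq (g : Geo Ω ρ) (h : TwoD (closure Ω) φ P Q) (hpos : ∀ x ∈ Ω, 0 < φ x)
    (hbd : ∀ x ∈ frontier Ω, φ x = 0)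
    (hν : ∀ x ∈ frontier Ω, P x (gradient ρ x) < 0) {x : F} (hx : x ∈ frontier Ω) :
    ∃ c : ℝ, 0 < c ∧ ∀ v, P x v = - c * fderiv ℝ ρ x v := by
  have hG := g.rho_grad_pos hx
  refine ⟨- P x (gradient ρ x) / fderiv ℝ ρ x (gradient ρ x), div_pos (by linarith [hν x hx]) hG, ?_⟩
  intro v
  have := g.P_tangent h hpos hbd hx
    (v := v - (fderiv ℝ ρ x v / fderiv ℝ ρ x (gradient ρ x)) • gradient ρ x) (by
      rw [map_sub, map_smul, smul_eq_mul, div_mul_cancel₀ _ hG.ne', sub_self])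
  rw [map_sub, map_smul, smul_eq_mul, sub_eq_zero] at this
  rw [this]
  field_simp

lemma Q_neg (g : Geo Ω ρ) (h : TwoD (closure Ω) φ P Q) (hpos : ∀ x ∈ Ω, 0 < φ x)
    (hbd : ∀ x ∈ frontier Ω, φ x = 0)
    (hν : ∀ x ∈ frontier Ω, P x (gradient ρ x) < 0) {x : F} (hx : x ∈ frontier Ω) {v : F}
    (hv : fderiv ℝ ρ x v = 0) (hv0 : v ≠ 0) : Q x v v < 0 := by
  obtain ⟨c, hc, hPc⟩ := g.P_eq h hpos hbd hν hx
  have hxK := g.closed_mem hx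
  have hx0 : ρ x = 0 := by have := hx; rw [g.fr] at this; exact this
  by_contra hQ
  push Not at hQ
  have hsc := g.sc x hx v hv0 hv
  set h2 : F → F →L[ℝ] F →L[ℝ] ℝ := fun z => Q z + c • fderiv ℝ (fderiv ℝ ρ) z with hh2
  set h1 : F → F →L[ℝ] ℝ := fun z => P z + c • fderiv ℝ ρ z with hh1
  set h0 : F → ℝ := fun z => φ z + c • ρ z with hh0
  have hd1 : ∀ z ∈ closure Ω, HasFDerivWithinAt h0 (h1 z) (closure Ω) z := fun z hz =>
    (h.d1 z hz).add ((g.diff z).hasFDerivAt.hasFDerivWithinAt.const_smul c)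
  have hd2 : ∀ z ∈ closure Ω, HasFDerivWithinAt h1 (h2 z) (closure Ω) z := fun z hz =>
    (h.d2 z hz).add ((g.diff2 z).hasFDerivAt.hasFDerivWithinAt.const_smul c)
  have hc2 : ContinuousOn h2 (closure Ω) := h.c2.add (g.cont2.continuousOn.const_smul c)
  have hpos2 : 0 < h2 x v v := by
    simp only [hh2, add_apply, smul_apply, smul_eq_mul]
    have := mul_pos hc hsc
    linarith
  have hcont : ContinuousWithinAt (fun p : F × F => h2 p.1 p.2 p.2) (closure Ω ×ˢ univ) (x, v) := by
    have e1 : ContinuousWithinAt (fun p : F × F => h2 p.1) (closure Ω ×ˢ univ) (x, v) :=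
      ContinuousWithinAt.comp (g := h2) (f := Prod.fst) (x := (x, v)) (t := closure Ω) (hc2 x hxK) continuous_fst.continuousWithinAt
        (fun (p : F × F) (hp : p ∈ closure Ω ×ˢ (univ : Set F)) => hp.1)
    have e2 : ContinuousWithinAt (fun p : F × F => p.2) (closure Ω ×ˢ univ) (x, v) :=
      continuous_snd.continuousWithinAt
    exact (e1.clm_apply e2).clm_apply e2
  have hev := hcont.eventually (lt_mem_nhds hpos2)
  rw [eventually_iff, Metric.mem_nhdsWithin_iff] at hev
  obtain ⟨ε, hε, hεs⟩ := hev
  have hG := g.rho_grad_pos hx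
  set G := gradient ρ x with hGdef
  obtain ⟨κ, hκ, hκε⟩ : ∃ κ : ℝ, 0 < κ ∧ κ * ‖G‖ < ε := by
    refine ⟨ε / (‖G‖ + 1), by positivity, ?_⟩
    rw [div_mul_eq_mul_div, div_lt_iff₀ (by positivity)]
    nlinarith [norm_nonneg G]
  have ev1 := g.inward (v := v - κ • G) hx (by
    rw [map_sub, map_smul, hv, smul_eq_mul]; nlinarith)
  have ev2 : ∀ᶠ t in 𝓝[>] (0:ℝ), 0 < ρ (x + t • (v + κ • G)) := by
    have hd := g.rho_line x (v + κ • G) 0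
    rw [zero_smul, add_zero] at hd
    have hp : 0 < fderiv ℝ ρ x (v + κ • G) := by
      rw [map_add, map_smul, hv, smul_eq_mul, zero_add]; positivity
    have := (hasDerivAt_iff_tendsto_slope.1 hd).eventually (lt_mem_nhds hp)
    have h3 := this.filter_mono (nhdsWithin_mono _ (fun t (ht : t ∈ Ioi (0:ℝ)) => ne_of_gt ht))
    filter_upwards [h3, self_mem_nhdsWithin] with t ht ht0
    rw [slope_def_field] at ht
    have ht0' : (0:ℝ) < t := ht0
    simp only [zero_smul, add_zero, sub_zero, hx0] at ht
    exact (div_pos_iff_of_pos_right ht0').1 ht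
  have ev3 : ∀ᶠ t in 𝓝[>] (0:ℝ), t * (‖v‖ + ε) < ε := by
    have : Continuous (fun t : ℝ => t * (‖v‖ + ε)) := by fun_prop
    have := (this.tendsto 0).eventually (gt_mem_nhds (show 0 * (‖v‖ + ε) < ε by simpa using hε))
    exact this.filter_mono nhdsWithin_le_nhds
  obtain ⟨t₀, ⟨hneg, hpos', hsmall⟩, ht₀⟩ := ((ev1.and (ev2.and ev3)).and self_mem_nhdsWithin).exists
  have ht₀' : (0:ℝ) < t₀ := ht₀
  -- IVT
  have hivt : ∃ σ ∈ Icc (-κ) κ, ρ (x + t₀ • (v + σ • G)) = 0 := by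
    have hcts : ContinuousOn (fun σ : ℝ => ρ (x + t₀ • (v + σ • G))) (Icc (-κ) κ) := by
      have := g.cd.continuous
      fun_prop
    have := intermediate_value_Icc (by linarith : -κ ≤ κ) hcts
    obtain ⟨σ, hσ, hσe⟩ := this (show (0:ℝ) ∈ Icc _ _ from ⟨by
      have : ρ (x + t₀ • (v - κ • G)) < 0 := by
        have h9 := hneg; rw [g.eqq] at h9; exact h9
      rw [neg_smul, ← sub_eq_add_neg]; exact this.le, hpos'.le⟩)
    exact ⟨σ, hσ, hσe⟩
  obtain ⟨σ, hσ, hσ0⟩ := hivt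
  set v' := v + σ • G with hv'
  have hv'd : ‖v' - v‖ < ε := by
    rw [hv', add_sub_cancel_left, norm_smul]
    refine lt_of_le_of_lt ?_ hκε
    gcongr
    rw [Real.norm_eq_abs, abs_le]
    exact hσ
  have hv'n : ‖v'‖ ≤ ‖v‖ + ε := by
    calc ‖v'‖ = ‖v + (v' - v)‖ := by rw [add_sub_cancel]
      _ ≤ ‖v‖ + ‖v' - v‖ := norm_add_le _ _
      _ ≤ _ := by linarith
  have hzf : x + t₀ • v' ∈ frontier Ω := by rw [g.fr]; exact hσ0
  have hzK := g.closed_mem hzf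
  have hL0 := fun s (hs : s ∈ Icc 0 t₀) => line_within g.conv hxK ht₀'.le hzK hd1 hs
  have hL1 := fun s (hs : s ∈ Icc 0 t₀) => line_within g.conv hxK ht₀'.le hzK hd2 hs
  have hL1' : ∀ s ∈ Icc 0 t₀, HasDerivWithinAt (fun t : ℝ => h1 (x + t • v') v')
      (h2 (x + s • v') v' v') (Icc 0 t₀) s := by
    intro s hs
    have := (hL1 s hs).2.clm_apply (hasDerivWithinAt_const s (Icc 0 t₀) v')
    simpa using this
  have hder2 : ∀ s ∈ Icc 0 t₀, 0 < h2 (x + s • v') v' v' := by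
    intro s hs
    refine hεs (show (x + s • v', v') ∈ _ from ⟨?_, ⟨(hL0 s hs).1, mem_univ _⟩⟩)
    rw [Metric.mem_ball, Prod.dist_eq, max_lt_iff]
    refine ⟨?_, by simpa [dist_eq_norm] using hv'd⟩
    simp only [dist_self_add_left, norm_smul, Real.norm_of_nonneg hs.1]
    calc s * ‖v'‖ ≤ t₀ * (‖v‖ + ε) := by
          have := hs.2
          gcongr
      _ < ε := hsmall
  have hm1 : StrictMonoOn (fun t : ℝ => h1 (x + t • v') v') (Icc 0 t₀) := by
    apply strictMonoOn_of_deriv_pos (convex_Icc 0 t₀)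
    · exact fun s hs => (hL1' s hs).continuousWithinAt
    · intro s hs
      rw [interior_Icc] at hs
      rw [((hL1' s ⟨hs.1.le, hs.2.le⟩).hasDerivAt (Icc_mem_nhds hs.1 hs.2)).deriv]
      exact hder2 s ⟨hs.1.le, hs.2.le⟩
  have hm0 : StrictMonoOn (fun t : ℝ => h0 (x + t • v')) (Icc 0 t₀) := by
    apply strictMonoOn_of_deriv_pos (convex_Icc 0 t₀)
    · exact fun s hs => (hL0 s hs).2.continuousWithinAt
    · intro s hs
      rw [interior_Icc] at hs
      rw [((hL0 s ⟨hs.1.le, hs.2.le⟩).2.hasDerivAt (Icc_mem_nhds hs.1 hs.2)).deriv]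
      have := hm1 (left_mem_Icc.2 ht₀'.le) ⟨hs.1.le, hs.2.le⟩ hs.1
      refine lt_of_eq_of_lt ?_ this
      simp [hh1, hPc]
  have := hm0 (left_mem_Icc.2 ht₀'.le) (right_mem_Icc.2 ht₀'.le) ht₀'
  simp only [zero_smul, add_zero, hh0, hbd x hx, hbd _ hzf, hσ0, hx0, smul_zero] at this
  exact lt_irrefl _ this

lemma concave_near (g : Geo Ω ρ) (h : TwoD (closure Ω) φ P Q) (hpos : ∀ x ∈ Ω, 0 < φ x)
    (hbd : ∀ x ∈ frontier Ω, φ x = 0)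
    (hν : ∀ x ∈ frontier Ω, P x (gradient ρ x) < 0) {x : F} (hx : x ∈ frontier Ω) :
    ∀ᶠ z in 𝓝 x, z ∈ Ω → ∀ v, φ z * Q z v v ≤ P z v ^ 2 := by
  obtain ⟨c, hc, hPc⟩ := g.P_eq h hpos hbd hν hx
  have hxK := g.closed_mem hx
  have key : ∀ᶠ z in 𝓝 x, ∀ v ∈ Metric.sphere (0:F) 1, z ∈ Ω → φ z * Q z v v ≤ P z v ^ 2 := by
    apply (isCompact_sphere (0:F) 1).eventually_forall_of_forall_eventually
    intro v hv
    have hv0 : v ≠ 0 := by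
      rintro rfl; simp at hv
    have hsub : ∀ p : F × F, p ∈ closure Ω ×ˢ (univ : Set F) → p.1 ∈ closure Ω := fun p hp => hp.1
    have e2 : ContinuousWithinAt (fun p : F × F => p.2) (closure Ω ×ˢ univ) (x, v) :=
      continuous_snd.continuousWithinAt
    have e0 : ContinuousWithinAt (fun p : F × F => φ p.1) (closure Ω ×ˢ univ) (x, v) :=
      ContinuousWithinAt.comp (t := closure Ω) (h.d1 x hxK).continuousWithinAt continuous_fst.continuousWithinAt hsub
    have eP : ContinuousWithinAt (fun p : F × F => P p.1) (closure Ω ×ˢ univ) (x, v) :=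
      ContinuousWithinAt.comp (t := closure Ω) (h.d2 x hxK).continuousWithinAt continuous_fst.continuousWithinAt hsub
    have eQ : ContinuousWithinAt (fun p : F × F => Q p.1) (closure Ω ×ˢ univ) (x, v) :=
      ContinuousWithinAt.comp (t := closure Ω) (h.c2 x hxK) continuous_fst.continuousWithinAt hsub
    have eQ' := (eQ.clm_apply e2).clm_apply e2
    have eP' := eP.clm_apply e2
    have hfin : ∀ᶠ p : F × F in 𝓝[closure Ω ×ˢ univ] (x, v), p.1 ∈ Ω → φ p.1 * Q p.1 p.2 p.2 ≤ P p.1 p.2 ^ 2 := by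
      by_cases hρv : fderiv ℝ ρ x v = 0
      · have hQ := g.Q_neg h hpos hbd hν hx hρv hv0
        filter_upwards [eQ'.eventually (gt_mem_nhds hQ)] with p hp hpΩ
        have := mul_neg_of_pos_of_neg (hpos _ hpΩ) hp
        nlinarith [sq_nonneg (P p.1 p.2)]
      · have hP : 0 < P x v ^ 2 - φ x * Q x v v := by
          rw [hbd x hx, hPc]
          have : 0 < (-c * fderiv ℝ ρ x v) ^ 2 := by
            exact sq_pos_of_ne_zero (mul_ne_zero (neg_ne_zero.2 hc.ne') hρv)
          linarith
        filter_upwards [((eP'.pow 2).sub (e0.mul eQ')).eventually (lt_mem_nhds hP)] with p hp hpΩ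
        have hp' : 0 < P p.1 p.2 ^ 2 - φ p.1 * Q p.1 p.2 p.2 := hp
        linarith
    rw [eventually_nhdsWithin_iff] at hfin
    filter_upwards [hfin] with p hp hpΩ
    exact hp ⟨subset_closure hpΩ, mem_univ _⟩ hpΩ
  filter_upwards [key] with z hz hzΩ v
  by_cases hv : v = 0
  · simp [hv]
  · have hn : 0 < ‖v‖ := norm_pos_iff.2 hv
    have := hz (‖v‖⁻¹ • v) (by simp [norm_smul, hn.ne']) hzΩ
    simp only [map_smul, smul_apply, smul_eq_mul] at this
    have h3 : ‖v‖⁻¹ ^ 2 * (φ z * Q z v v) ≤ ‖v‖⁻¹ ^ 2 * P z v ^ 2 := by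
      calc _ = φ z * (‖v‖⁻¹ * (‖v‖⁻¹ * Q z v v)) := by ring
        _ ≤ _ := this
        _ = _ := by ring
    exact le_of_mul_le_mul_left h3 (by positivity)
end Geo
end

section
set_option linter.unusedSectionVars false
set_option maxSynthPendingDepth 3
open Filter Topology
variable {F : Type*} [NormedAddCommGroup F] [InnerProductSpace ℝ F] [FiniteDimensional ℝ F]

lemma hasDerivAt_norm_line {w : F} (hw : w ≠ 0) (v : F) :
    HasDerivAt (fun t : ℝ => ‖w + t • v‖) (⟪w, v⟫ / ‖w‖) 0 := by
  have e1 : (fun t : ℝ => ‖w + t • v‖) = fun t => Real.sqrt (‖w‖ ^ 2 + 2 * t * ⟪w, v⟫ + t ^ 2 * ‖v‖ ^ 2) := by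
    funext t
    rw [← Real.sqrt_sq (norm_nonneg (w + t • v)), norm_add_sq_real, norm_smul, inner_smul_right,
      Real.norm_eq_abs, mul_pow, sq_abs]
    ring_nf
  have hn : 0 < ‖w‖ := norm_pos_iff.2 hw
  rw [e1]
  have h1 : HasDerivAt (fun t : ℝ => ‖w‖ ^ 2 + 2 * t * ⟪w, v⟫ + t ^ 2 * ‖v‖ ^ 2) (2 * ⟪w, v⟫) 0 := by
    have h2 : HasDerivAt (fun t : ℝ => 2 * t * ⟪w, v⟫) (2 * ⟪w, v⟫) 0 := by
      simpa using ((hasDerivAt_id (0:ℝ)).const_mul 2).mul_const ⟪w, v⟫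
    have h3 : HasDerivAt (fun t : ℝ => t ^ 2 * ‖v‖ ^ 2) 0 0 := by
      simpa using (hasDerivAt_pow 2 (0:ℝ)).mul_const (‖v‖ ^ 2)
    exact ((h2.const_add (‖w‖ ^ 2)).add h3).congr_deriv (by simp)
  have h4 := h1.sqrt (by simp [hn.ne'])
  refine h4.congr_deriv ?_
  simp
  field_simp

/-- reflection -/
noncomputable def refl_e (e : F) : F →L[ℝ] F :=
  ContinuousLinearMap.id ℝ F - (2:ℝ) • (innerSL ℝ e).smulRight e

lemma refl_e_apply (e v : F) : refl_e e v = v - (2 * ⟪e, v⟫) • e := by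
  simp [refl_e, smul_smul]

lemma refl_e_self {e : F} (he : ‖e‖ = 1) : refl_e e e = - e := by
  rw [refl_e_apply, real_inner_self_eq_norm_sq, he]; module

variable {ι : Type*} [Fintype ι]

lemma basis_expand (b : OrthonormalBasis ι ℝ F) (e : F) (l : F →L[ℝ] ℝ) :
    ∑ i, ⟪e, b i⟫ * l (b i) = l e := by
  conv_rhs => rw [← b.sum_repr' e]
  simp [real_inner_comm]

lemma basis_inner_sq (b : OrthonormalBasis ι ℝ F) {e : F} (he : ‖e‖ = 1) :
    ∑ i, ⟪e, b i⟫ ^ 2 = 1 := by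
  have := b.sum_inner_mul_inner e e
  rw [real_inner_self_eq_norm_sq, he] at this
  calc _ = ∑ i, ⟪e, b i⟫ * ⟪b i, e⟫ := by
        apply Finset.sum_congr rfl; intro i _; rw [real_inner_comm e (b i)]; ring
    _ = _ := by rw [this]; norm_num

lemma trace_refl (b : OrthonormalBasis ι ℝ F) {e : F} (he : ‖e‖ = 1) (B : F →L[ℝ] F →L[ℝ] ℝ) :
    ∑ i, B (refl_e e (b i)) (refl_e e (b i)) = ∑ i, B (b i) (b i) := by
  have h : ∀ i, B (refl_e e (b i)) (refl_e e (b i)) = B (b i) (b i)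
      - 2 * (⟪e, b i⟫ * B e (b i)) - 2 * (⟪e, b i⟫ * B.flip e (b i)) + 4 * B e e * ⟪e, b i⟫ ^ 2 := by
    intro i
    rw [refl_e_apply]
    simp
    ring
  simp only [h, Finset.sum_add_distrib, Finset.sum_sub_distrib, ← Finset.mul_sum]
  rw [basis_inner_sq b he, basis_expand b e (B e), basis_expand b e (B.flip e)]
  simp
  ring

noncomputable def Zf (U1 : F → F →L[ℝ] ℝ) (ψ : ℝ → ℝ) (p : F × F) : ℝ :=
  (U1 p.2 - U1 p.1) (p.2 - p.1) / ‖p.2 - p.1‖ - 2 * ψ (‖p.2 - p.1‖ / 2)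

lemma Zf_swap (U1 : F → F →L[ℝ] ℝ) (ψ : ℝ → ℝ) (p : F × F) : Zf U1 ψ p.swap = Zf U1 ψ p := by
  simp only [Zf, Prod.fst_swap, Prod.snd_swap]
  rw [norm_sub_rev p.1 p.2, ← neg_sub p.2 p.1, ← neg_sub (U1 p.2) (U1 p.1)]
  simp only [map_neg, neg_apply, neg_neg]

lemma fo_y {Ω : Set F} {U1 : F → F →L[ℝ] ℝ} {U2 : F → F →L[ℝ] F →L[ℝ] ℝ}
    (hU2 : ∀ x ∈ Ω, HasFDerivAt U1 (U2 x) x) {ψ : ℝ → ℝ} {ψ1 : ℝ} {x y e : F} {d : ℝ}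
    (hy : y ∈ Ω) (hd0 : 0 < d) (he : ‖e‖ = 1) (hyx : y - x = d • e)
    (hψ : HasDerivAt ψ ψ1 (d / 2)) (hmax : IsLocalMax (Zf U1 ψ) (x, y)) (v : F) :
    U2 y v e = - (U1 y - U1 x) v / d + ⟪e, v⟫ * (U1 y - U1 x) e / d + ψ1 * ⟪e, v⟫ := by
  have hd : ‖y - x‖ = d := by rw [hyx, norm_smul, he, Real.norm_of_nonneg hd0.le, mul_one]
  have hw : y - x ≠ 0 := by rw [← norm_pos_iff, hd]; exact hd0
  have hline : HasDerivAt (fun t : ℝ => U1 (y + t • v)) (U2 y v) 0 := by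
    have h1 : HasFDerivAt U1 (U2 y) (y + (0:ℝ) • v) := by
      rw [zero_smul, add_zero]; exact hU2 y hy
    exact h1.comp_hasDerivAt (0:ℝ) (hasDerivAt_line y v 0)
  have hn := hasDerivAt_norm_line hw v
  have hin : ⟪y - x, v⟫ / ‖y - x‖ = ⟪e, v⟫ := by
    rw [hd, hyx, inner_smul_left]
    simp
    field_simp
  rw [hin] at hn
  have h1 : HasDerivAt (fun t : ℝ => (U1 (y + t • v) - U1 x) (y - x + t • v))
      (U2 y v (y - x) + (U1 y - U1 x) v) 0 := by
    have := (hline.sub_const (U1 x)).clm_apply (hasDerivAt_line (y - x) v 0)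
    refine this.congr_deriv ?_
    simp
  have hψ' : HasDerivAt ψ ψ1 (‖y - x + (0:ℝ) • v‖ / 2) := by
    rw [zero_smul, add_zero, hd]; exact hψ
  have h2 := (h1.div hn (by simpa using hw)).sub ((hψ'.comp (0:ℝ) (hn.div_const 2)).const_mul 2)
  have hm : IsLocalMax (fun t : ℝ => Zf U1 ψ (x, y + t • v)) 0 := by
    have : IsLocalMax (Zf U1 ψ) (x, y + (0:ℝ) • v) := by simpa using hmax
    exact this.comp_continuous (g := fun t : ℝ => (x, y + t • v)) (by fun_prop)
  have h3 := hm.hasDerivAt_eq_zero (h2.congr_of_eventuallyEq (Eventually.of_forall fun t => by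
    simp only [Zf, Function.comp, Pi.div_apply, Pi.sub_apply]
    rw [add_sub_right_comm]))
  have k1 : U2 y v (y - x) = d * U2 y v e := by rw [hyx, map_smul, smul_eq_mul]
  have k2 : (U1 y - U1 x) (y - x) = d * (U1 y - U1 x) e := by rw [hyx, map_smul, smul_eq_mul]
  simp only [zero_smul, add_zero] at h3
  rw [k1, k2, hd] at h3
  generalize (U1 y - U1 x) v = A1 at *
  generalize (U1 y - U1 x) e = A2 at *
  generalize U2 y v e = A3 at *
  field_simp at h3 ⊢
  linarith

lemma fo_x {Ω : Set F} {U1 : F → F →L[ℝ] ℝ} {U2 : F → F →L[ℝ] F →L[ℝ] ℝ}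
    (hU2 : ∀ x ∈ Ω, HasFDerivAt U1 (U2 x) x) {ψ : ℝ → ℝ} {ψ1 : ℝ} {x y e : F} {d : ℝ}
    (hx : x ∈ Ω) (hd0 : 0 < d) (he : ‖e‖ = 1) (hyx : y - x = d • e)
    (hψ : HasDerivAt ψ ψ1 (d / 2)) (hmax : IsLocalMax (Zf U1 ψ) (x, y)) (v : F) :
    U2 x v e = - (U1 y - U1 x) v / d + ⟪e, v⟫ * (U1 y - U1 x) e / d + ψ1 * ⟪e, v⟫ := by
  have hm : IsLocalMax (Zf U1 ψ) (y, x) := by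
    have h0 : IsLocalMax (Zf U1 ψ) ((y, x) : F × F).swap := hmax
    have := h0.comp_continuous (g := Prod.swap) (b := (y, x)) (by fun_prop)
    refine this.congr (Eventually.of_forall fun p => Zf_swap U1 ψ p)
  have := fo_y hU2 (e := -e) hx hd0 (by rw [norm_neg, he]) (by rw [smul_neg, ← hyx]; abel) hψ hm v
  rw [← neg_sub (U1 y) (U1 x)] at this
  simp only [map_neg, neg_apply, inner_neg_left] at this
  linear_combination -this

set_option maxHeartbeats 1600000 in
lemma third_cond (b : OrthonormalBasis ι ℝ F) {Ω : Set F} (hΩ : IsOpen Ω)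
    {U0 : F → ℝ} {U1 : F → F →L[ℝ] ℝ} {U2 : F → F →L[ℝ] F →L[ℝ] ℝ}
    (hU1 : ∀ x ∈ Ω, HasFDerivAt U0 (U1 x) x) (hU2 : ∀ x ∈ Ω, HasFDerivAt U1 (U2 x) x)
    (hU2c : ContinuousOn U2 Ω) 
    {q : F → ℝ} {q1 : F → F →L[ℝ] ℝ} {lam : ℝ}
    (hq1 : ∀ x ∈ Ω, HasStrictFDerivAt q (q1 x) x)
    (heq : ∀ x ∈ Ω, ∑ i, U2 x (b i) (b i) = q x - lam - ∑ i, (U1 x (b i)) ^ 2)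
    {G0 ψ ψ1 : ℝ → ℝ} {ψ2 : ℝ} {x y e : F} {d : ℝ} (hx : x ∈ Ω) (hy : y ∈ Ω) 
    (hd0 : 0 < d) (he : ‖e‖ = 1) (hyx : y - x = d • e)
    (hG0 : ∀ᶠ z in 𝓝 (d / 2), HasDerivAt G0 (ψ z) z)
    (hψ : ∀ᶠ z in 𝓝 (d / 2), HasDerivAt ψ (ψ1 z) z)
    (hψ1 : HasStrictDerivAt ψ1 ψ2 (d / 2))
    (hmax : IsLocalMax (Zf U1 ψ) (x, y)) :
    (q1 y - ∑ i, (2 * U1 y (b i)) • (U2 y).flip (b i)) e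
      - (q1 x - ∑ i, (2 * U1 x (b i)) • (U2 x).flip (b i)) e - 2 * ψ2 ≤ 0 := by
  have hee : ⟪e, e⟫ = 1 := by rw [real_inner_self_eq_norm_sq, he]; norm_num
  set R := refl_e e with hR
  have hcy : Tendsto (fun v : F => y + R v) (𝓝 0) (𝓝 y) := by
    have : Continuous (fun v : F => y + R v) := by fun_prop
    simpa using this.tendsto 0
  have hcx : Tendsto (fun v : F => x + v) (𝓝 0) (𝓝 x) := by
    have : Continuous (fun v : F => x + v) := by fun_prop
    simpa using this.tendsto 0
  have hcd : Tendsto (fun v : F => d / 2 - ⟪e, v⟫) (𝓝 0) (𝓝 (d / 2)) := by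
    have : Continuous (fun v : F => d / 2 - ⟪e, v⟫) := by fun_prop
    simpa using this.tendsto 0
  have hgood : ∀ᶠ v in 𝓝 (0:F), y + R v ∈ Ω ∧ x + v ∈ Ω ∧
      HasDerivAt G0 (ψ (d / 2 - ⟪e, v⟫)) (d / 2 - ⟪e, v⟫) ∧
      HasDerivAt ψ (ψ1 (d / 2 - ⟪e, v⟫)) (d / 2 - ⟪e, v⟫) ∧ 0 < d / 2 - ⟪e, v⟫ :=
    (hcy.eventually (hΩ.mem_nhds hy)).and ((hcx.eventually (hΩ.mem_nhds hx)).and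
      ((hcd.eventually hG0).and ((hcd.eventually hψ).and
        (hcd.eventually (lt_mem_nhds (by positivity))))))
  set H : F → ℝ := fun v => - U0 (y + R v) - U0 (x + v) + 2 * G0 (d / 2 - ⟪e, v⟫) with hH
  set a : F → F → ℝ := fun c v => - U1 (y + R v) (R c) - U1 (x + v) c
    + 2 * (ψ (d / 2 - ⟪e, v⟫) * (- ⟪e, c⟫)) with ha
  set A : F → F → ℝ := fun c v => - U2 (y + R v) (R c) (R c) - U2 (x + v) c c
    + 2 * (ψ1 (d / 2 - ⟪e, v⟫) * (- ⟪e, c⟫) * (- ⟪e, c⟫)) with hA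
  have lin1 : ∀ v c : F, HasDerivAt (fun t : ℝ => y + R (v + t • c)) (R c) 0 := by
    intro v c
    have := hasDerivAt_line (y + R v) (R c) 0
    refine this.congr_of_eventuallyEq (Eventually.of_forall fun t => ?_)
    simp [add_assoc]
  have lin2 : ∀ v c : F, HasDerivAt (fun t : ℝ => x + (v + t • c)) c 0 := by
    intro v c
    have := hasDerivAt_line (x + v) c 0
    refine this.congr_of_eventuallyEq (Eventually.of_forall fun t => ?_)
    simp [add_assoc]
  have lin3 : ∀ v c : F, HasDerivAt (fun t : ℝ => d / 2 - ⟪e, v + t • c⟫) (- ⟪e, c⟫) 0 := by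
    intro v c
    have := ((hasDerivAt_id (0:ℝ)).mul_const ⟪e, c⟫).const_sub (d / 2 - ⟪e, v⟫)
    rw [one_mul] at this
    refine this.congr_of_eventuallyEq (Eventually.of_forall fun t => ?_)
    simp [inner_add_right, inner_smul_right]
    ring
  have hder1 : ∀ᶠ v in 𝓝 (0:F), ∀ c, HasDerivAt (fun t : ℝ => H (v + t • c)) (a c v) 0 := by
    filter_upwards [hgood] with v hv c
    have e1 : HasFDerivAt U0 (U1 (y + R v)) (y + R (v + (0:ℝ) • c)) := by
      simpa using hU1 _ hv.1
    have e2 : HasFDerivAt U0 (U1 (x + v)) (x + (v + (0:ℝ) • c)) := by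
      simpa using hU1 _ hv.2.1
    have e3 : HasDerivAt G0 (ψ (d / 2 - ⟪e, v⟫)) (d / 2 - ⟪e, v + (0:ℝ) • c⟫) := by
      simpa using hv.2.2.1
    have := ((e1.comp_hasDerivAt (0:ℝ) (lin1 v c)).neg.sub (e2.comp_hasDerivAt (0:ℝ) (lin2 v c))).add
      ((e3.comp (0:ℝ) (lin3 v c)).const_mul 2)
    exact this
  have hder2 : ∀ᶠ v in 𝓝 (0:F), ∀ c, HasDerivAt (fun t : ℝ => a c (v + t • c)) (A c v) 0 := by
    filter_upwards [hgood] with v hv c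
    have e1 : HasFDerivAt U1 (U2 (y + R v)) (y + R (v + (0:ℝ) • c)) := by
      simpa using hU2 _ hv.1
    have e2 : HasFDerivAt U1 (U2 (x + v)) (x + (v + (0:ℝ) • c)) := by
      simpa using hU2 _ hv.2.1
    have e3 : HasDerivAt ψ (ψ1 (d / 2 - ⟪e, v⟫)) (d / 2 - ⟪e, v + (0:ℝ) • c⟫) := by
      simpa using hv.2.2.2.1
    have f1 := (e1.comp_hasDerivAt (0:ℝ) (lin1 v c)).clm_apply (hasDerivAt_const (0:ℝ) (R c))
    have f2 := (e2.comp_hasDerivAt (0:ℝ) (lin2 v c)).clm_apply (hasDerivAt_const (0:ℝ) c)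
    have f3 := ((e3.comp (0:ℝ) (lin3 v c)).mul_const (- ⟪e, c⟫)).const_mul 2
    have := (f1.neg.sub f2).add f3
    simp only [map_zero, add_zero] at this
    exact this
  -- sum of A
  set S : F → ℝ := fun z => q z - lam - ∑ i, (U1 z (b i)) ^ 2 with hS
  have hsum : ∀ᶠ v in 𝓝 (0:F), - S (y + R v) - S (x + v) + 2 * ψ1 (d / 2 - ⟪e, v⟫) = ∑ i, A (b i) v := by
    filter_upwards [hgood] with v hv
    simp only [hA, hS]
    rw [← heq _ hv.1, ← heq _ hv.2.1, ← trace_refl b he (U2 (y + R v))]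
    simp only [Finset.sum_add_distrib, Finset.sum_sub_distrib, Finset.sum_neg_distrib,
      ← Finset.mul_sum, ← hR]
    congr 2
    have : ∀ i, ψ1 (d / 2 - ⟪e, v⟫) * (- ⟪e, b i⟫) * (- ⟪e, b i⟫) = ψ1 (d / 2 - ⟪e, v⟫) * ⟪e, b i⟫ ^ 2 :=
      fun i => by ring
    simp only [this, ← Finset.mul_sum]
    rw [basis_inner_sq b he, mul_one]
  set S1 : F → F →L[ℝ] ℝ := fun z => q1 z - ∑ i, (2 * U1 z (b i)) • (U2 z).flip (b i) with hS1
  have hSd : ∀ z ∈ Ω, HasStrictFDerivAt S (S1 z) z := by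
    intro z hz
    have hs1 : HasStrictFDerivAt U1 (U2 z) z :=
      hasStrictFDerivAt_of_hasFDerivAt_of_continuousAt
        (by filter_upwards [hΩ.mem_nhds hz] with z' hz' using hU2 z' hz')
        (hU2c.continuousAt (hΩ.mem_nhds hz))
    have hs2 : ∀ i, HasStrictFDerivAt (fun z => (U1 z (b i)) ^ 2) ((2 * U1 z (b i)) • (U2 z).flip (b i)) z := by
      intro i
      have := (hs1.clm_apply (hasStrictFDerivAt_const (b i) z)).pow 2
      refine this.congr_fderiv ?_
      ext v
      simp
    have := ((hq1 z hz).sub_const lam).sub (HasStrictFDerivAt.fun_sum (u := Finset.univ) (fun i _ => hs2 i))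
    exact this
  set L' : F →L[ℝ] ℝ := - (S1 y).comp R - S1 x + (2:ℝ) • (ψ2 • (- innerSL ℝ e)) with hL'
  have hLs : HasStrictFDerivAt (fun v => ∑ i, A (b i) v) L' 0 := by
    refine HasStrictFDerivAt.congr_of_eventuallyEq ?_ hsum
    have e1 : HasStrictFDerivAt (fun v : F => y + R v) R 0 := R.hasStrictFDerivAt.const_add y
    have e2 : HasStrictFDerivAt (fun v : F => x + v) (ContinuousLinearMap.id ℝ F) 0 :=
      (hasStrictFDerivAt_id (0:F)).const_add x
    have e3 : HasStrictFDerivAt (fun v : F => d / 2 - ⟪e, v⟫) (- innerSL ℝ e) 0 :=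
      (innerSL ℝ e).hasStrictFDerivAt.const_sub (d / 2)
    have f1 : HasStrictFDerivAt S (S1 y) (y + R 0) := by simpa using hSd y hy
    have f2 : HasStrictFDerivAt S (S1 x) (x + 0) := by simpa using hSd x hx
    have f3 : HasStrictDerivAt ψ1 ψ2 (d / 2 - ⟪e, (0:F)⟫) := by simpa using hψ1
    have := ((f1.comp (0:F) e1).neg.sub (f2.comp (0:F) e2)).add
      ((f3.comp_hasStrictFDerivAt (0:F) e3).const_smul (2:ℝ))
    refine HasStrictFDerivAt.congr_fderiv this ?_
    ext v
    simp [hL']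
  have hk_eq : ∀ᶠ v in 𝓝 (0:F), a e v = Zf U1 ψ (x + v, y + R v) := by
    filter_upwards [hgood] with v hv
    have h1 : y + R v - (x + v) = (2 * (d / 2 - ⟪e, v⟫)) • e := by
      calc y + R v - (x + v) = (y - x) + (R v - v) := by abel
        _ = _ := by rw [hyx, hR, refl_e_apply]; module
    have hp : 0 < 2 * (d / 2 - ⟪e, v⟫) := by linarith [hv.2.2.2.2]
    have h2 : ‖(2 * (d / 2 - ⟪e, v⟫)) • e‖ = 2 * (d / 2 - ⟪e, v⟫) := by
      rw [norm_smul, he, mul_one, Real.norm_of_nonneg hp.le]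
    simp only [ha, Zf]
    rw [h1, h2, map_smul, hR, refl_e_self he, hee, smul_eq_mul, mul_div_cancel_left₀ _ hp.ne',
      mul_div_cancel_left₀ _ (two_ne_zero)]
    simp
    ring
  have hkm : IsLocalMax (a e) 0 := by
    have h1 : IsLocalMax (Zf U1 ψ) (x + (0:F), y + R 0) := by simpa using hmax
    have h2 : IsLocalMax (fun v => Zf U1 ψ (x + v, y + R v)) 0 :=
      h1.comp_continuous (g := fun v : F => (x + v, y + R v)) (by fun_prop)
    exact h2.congr (hk_eq.mono fun v hv => hv.symm)
  have hU1c : ∀ z ∈ Ω, ContinuousAt U1 z := fun z hz => (hU2 z hz).continuousAt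
  have hkc : ContinuousAt (a e) 0 := by
    have c1 : ContinuousAt (fun v : F => U1 (y + R v)) 0 :=
      ContinuousAt.comp (g := U1) (by simpa using hU1c y hy) (by fun_prop)
    have c2 : ContinuousAt (fun v : F => U1 (x + v)) 0 :=
      ContinuousAt.comp (g := U1) (by simpa using hU1c x hx) (by fun_prop)
    have c3 : ContinuousAt (fun v : F => ψ (d / 2 - ⟪e, v⟫)) 0 :=
      ContinuousAt.comp (g := ψ) (by simpa using hψ.self_of_nhds.continuousAt) (by fun_prop)
    simp only [ha]
    exact ((c1.clm_apply continuousAt_const).neg.sub (c2.clm_apply continuousAt_const)).add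
      (continuousAt_const.mul (c3.mul continuousAt_const))
  have hHc : ∀ᶠ v in 𝓝 (0:F), ContinuousAt H v := by
    filter_upwards [hgood] with v hv
    have c1 : ContinuousAt (fun v : F => U0 (y + R v)) v :=
      ContinuousAt.comp (g := U0) (hU1 _ hv.1).continuousAt (by fun_prop)
    have c2 : ContinuousAt (fun v : F => U0 (x + v)) v :=
      ContinuousAt.comp (g := U0) (hU1 _ hv.2.1).continuousAt (by fun_prop)
    have c3 : ContinuousAt (fun v : F => G0 (d / 2 - ⟪e, v⟫)) v :=
      ContinuousAt.comp (g := G0) hv.2.2.1.continuousAt (by fun_prop)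
    exact (c1.neg.sub c2).add (continuousAt_const.mul c3)
  have third := third_order (fun i => b i) (fun i => b.norm_eq_one i) e he H (a e)
    (fun i => a (b i)) (fun i => A (b i)) L'
    (hder1.mono fun v hv => hv e) hHc (hder1.mono fun v hv i => hv (b i))
    (hder2.mono fun v hv i => hv (b i)) hLs hkc hkm
  have hL'e : L' e = S1 y e - S1 x e - 2 * ψ2 := by
    simp only [hL']
    simp [hR, refl_e_self he, he]
    ring
  rw [hL'e] at third
  exact third

set_option maxHeartbeats 800000 in
lemma Z_max (b : OrthonormalBasis ι ℝ F) {Ω : Set F} (hΩ : IsOpen Ω)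
    {U0 : F → ℝ} {U1 : F → F →L[ℝ] ℝ} {U2 : F → F →L[ℝ] F →L[ℝ] ℝ}
    (hU1 : ∀ x ∈ Ω, HasFDerivAt U0 (U1 x) x) (hU2 : ∀ x ∈ Ω, HasFDerivAt U1 (U2 x) x)
    (hU2c : ContinuousOn U2 Ω) (hsym : ∀ x ∈ Ω, ∀ v w, U2 x v w = U2 x w v)
    {q : F → ℝ} {q1 : F → F →L[ℝ] ℝ} {lam : ℝ}
    (hq1 : ∀ x ∈ Ω, HasStrictFDerivAt q (q1 x) x)
    (hqm : ∀ x ∈ Ω, ∀ y ∈ Ω, 0 ≤ (q1 y - q1 x) (y - x))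
    (heq : ∀ x ∈ Ω, ∑ i, U2 x (b i) (b i) = q x - lam - ∑ i, (U1 x (b i)) ^ 2)
    {G0 ψ ψ1 : ℝ → ℝ} {ψ2 : ℝ} {x y : F} (hx : x ∈ Ω) (hy : y ∈ Ω) (hxy : x ≠ y)
    (hG0 : ∀ᶠ z in 𝓝 (‖y - x‖ / 2), HasDerivAt G0 (ψ z) z)
    (hψ : ∀ᶠ z in 𝓝 (‖y - x‖ / 2), HasDerivAt ψ (ψ1 z) z)
    (hψ1 : HasStrictDerivAt ψ1 ψ2 (‖y - x‖ / 2))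
    (hode : ψ2 + 2 * ψ (‖y - x‖ / 2) * ψ1 (‖y - x‖ / 2) = 0)
    (hneg : ψ1 (‖y - x‖ / 2) < 0)
    (hmax : IsLocalMax (Zf U1 ψ) (x, y)) : Zf U1 ψ (x, y) ≤ 0 := by
  have hw : y - x ≠ 0 := sub_ne_zero.2 hxy.symm
  set d := ‖y - x‖ with hd
  have hd0 : 0 < d := norm_pos_iff.2 hw
  set e : F := d⁻¹ • (y - x) with he_def
  have he : ‖e‖ = 1 := by
    rw [he_def, norm_smul, norm_inv, norm_norm, ← hd, inv_mul_cancel₀ hd0.ne']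
  have hyx : y - x = d • e := by rw [he_def, smul_smul, mul_inv_cancel₀ hd0.ne', one_smul]
  have hee : ⟪e, e⟫ = 1 := by rw [real_inner_self_eq_norm_sq, he]; norm_num
  set δ : F →L[ℝ] ℝ := U1 y - U1 x with hδ
  have hZ : Zf U1 ψ (x, y) = δ e - 2 * ψ (d / 2) := by
    simp only [Zf]
    rw [← hd, hyx, map_smul, smul_eq_mul, ← hδ]
    field_simp
  have hψ0 := hψ.self_of_nhds
  have third := third_cond b hΩ hU1 hU2 hU2c hq1 heq hx hy hd0 he hyx hG0 hψ hψ1 hmax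
  have fy := fun v => fo_y hU2 hy hd0 he hyx hψ0 hmax v
  have fx := fun v => fo_x hU2 hx hd0 he hyx hψ0 hmax v
  simp only [← hδ] at fy fx
  -- conclude
  have hSe : ∀ z ∈ Ω, (∀ v, U2 z v e = - δ v / d + ⟪e, v⟫ * δ e / d + ψ1 (d / 2) * ⟪e, v⟫) →
      (q1 z - ∑ i, (2 * U1 z (b i)) • (U2 z).flip (b i)) e = q1 z e - 2 * ∑ i, U1 z (b i) * (- δ (b i) / d + ⟪e, b i⟫ * δ e / d + ψ1 (d / 2) * ⟪e, b i⟫) := by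
    intro z hz hfo
    simp only [sub_apply, sum_apply, smul_apply, ContinuousLinearMap.flip_apply, smul_eq_mul]
    rw [Finset.mul_sum]
    congr 1
    apply Finset.sum_congr rfl
    intro i _
    rw [hsym z hz, hfo]
    ring
  rw [hSe y hy fy, hSe x hx fx] at third
  have hq' : 0 ≤ q1 y e - q1 x e := by
    have := hqm x hx y hy
    rw [hyx, map_smul, smul_eq_mul] at this
    have := nonneg_of_mul_nonneg_right this hd0
    simpa using this
  have hdiff : ∑ i, U1 y (b i) * (- δ (b i) / d + ⟪e, b i⟫ * δ e / d + ψ1 (d / 2) * ⟪e, b i⟫)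
      - ∑ i, U1 x (b i) * (- δ (b i) / d + ⟪e, b i⟫ * δ e / d + ψ1 (d / 2) * ⟪e, b i⟫)
      = - (∑ i, δ (b i) ^ 2) / d + (δ e / d + ψ1 (d / 2)) * δ e := by
    rw [← Finset.sum_sub_distrib]
    have h1 : ∀ i, U1 y (b i) * (- δ (b i) / d + ⟪e, b i⟫ * δ e / d + ψ1 (d / 2) * ⟪e, b i⟫)
      - U1 x (b i) * (- δ (b i) / d + ⟪e, b i⟫ * δ e / d + ψ1 (d / 2) * ⟪e, b i⟫)
      = - (1 / d) * δ (b i) ^ 2 + (δ e / d + ψ1 (d / 2)) * (⟪e, b i⟫ * δ (b i)) := by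
      intro i
      have : δ (b i) = U1 y (b i) - U1 x (b i) := by simp [hδ]
      rw [← sub_mul, ← this]
      ring
    simp only [h1, Finset.sum_add_distrib, ← Finset.mul_sum]
    rw [basis_expand b e δ]
    ring
  have hCS : δ e ^ 2 ≤ ∑ i, δ (b i) ^ 2 := by
    have := Finset.sum_mul_sq_le_sq_mul_sq Finset.univ (fun i => ⟪e, b i⟫) (fun i => δ (b i))
    rw [basis_expand b e δ, basis_inner_sq b he, one_mul] at this
    exact this
  have hCS' : - (∑ i, δ (b i) ^ 2) / d + (δ e / d + ψ1 (d / 2)) * δ e ≤ ψ1 (d / 2) * δ e := by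
    have : (δ e ^ 2) / d ≤ (∑ i, δ (b i) ^ 2) / d := by gcongr
    have e1 : (δ e / d + ψ1 (d / 2)) * δ e = δ e ^ 2 / d + ψ1 (d / 2) * δ e := by ring
    rw [e1, neg_div]
    linarith
  rw [hZ]
  by_contra hcon
  push Not at hcon
  have hfin : 0 ≤ ψ2 + ψ1 (d / 2) * δ e := by linarith
  have : ψ1 (d / 2) * (δ e - 2 * ψ (d / 2)) < 0 := mul_neg_of_neg_of_pos hneg hcon
  nlinarith
end

section
set_option linter.unusedSectionVars false
set_option maxSynthPendingDepth 3
open Filter Topology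
variable {F : Type*} [NormedAddCommGroup F] [InnerProductSpace ℝ F] [FiniteDimensional ℝ F]
variable {ι : Type*} [Fintype ι]

/-- the comparison function -/
structure Psi (T : ℝ) (G0 ψ ψ1 ψ2 : ℝ → ℝ) : Prop where
  pos : 0 < T
  dG : ∀ z ∈ Ioo (-T) T, HasDerivAt G0 (ψ z) z
  dψ : ∀ z ∈ Ioo (-T) T, HasDerivAt ψ (ψ1 z) z
  dψ1 : ∀ z ∈ Ioo (-T) T, HasStrictDerivAt ψ1 (ψ2 z) z
  ode : ∀ z ∈ Ioo (-T) T, ψ2 z + 2 * ψ z * ψ1 z = 0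
  neg : ∀ z ∈ Ioo (-T) T, ψ1 z < 0
  zero : ψ 0 = 0

noncomputable def UU1 (φ : F → ℝ) (P : F → F →L[ℝ] ℝ) (z : F) : F →L[ℝ] ℝ := (φ z)⁻¹ • P z
noncomputable def UU2 (φ : F → ℝ) (P : F → F →L[ℝ] ℝ) (Q : F → F →L[ℝ] F →L[ℝ] ℝ) (z : F) :
    F →L[ℝ] F →L[ℝ] ℝ := (φ z)⁻¹ • Q z - (((φ z)⁻¹) ^ 2) • (P z).smulRight (P z)

lemma tendsto_clm_ap {α : Type*} {l : Filter α} {A : α → F →L[ℝ] ℝ} {B : α → F} {A' : F →L[ℝ] ℝ}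
    {B' : F} (hA : Tendsto A l (𝓝 A')) (hB : Tendsto B l (𝓝 B')) :
    Tendsto (fun t => A t (B t)) l (𝓝 (A' B')) := by
  have hc : Continuous (fun p : (F →L[ℝ] ℝ) × F => p.1 p.2) := by fun_prop
  exact (hc.tendsto (A', B')).comp (hA.prodMk_nhds hB)

section U
variable {Ω : Set F} {ρ φ : F → ℝ} {P : F → F →L[ℝ] ℝ} {Q : F → F →L[ℝ] F →L[ℝ] ℝ}

lemma UU2_apply (z v w : F) : UU2 φ P Q z v w = (φ z)⁻¹ * Q z v w - ((φ z)⁻¹) ^ 2 * (P z v * P z w) := by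
  simp [UU2]

lemma TwoD.at1 (h : TwoD (closure Ω) φ P Q) (ho : IsOpen Ω) {z : F} (hz : z ∈ Ω) :
    HasFDerivAt φ (P z) z :=
  (h.d1 z (subset_closure hz)).hasFDerivAt (mem_of_superset (ho.mem_nhds hz) subset_closure)

lemma TwoD.at2 (h : TwoD (closure Ω) φ P Q) (ho : IsOpen Ω) {z : F} (hz : z ∈ Ω) :
    HasFDerivAt P (Q z) z :=
  (h.d2 z (subset_closure hz)).hasFDerivAt (mem_of_superset (ho.mem_nhds hz) subset_closure)

lemma UU1_deriv (h : TwoD (closure Ω) φ P Q) (ho : IsOpen Ω) (hpos : ∀ x ∈ Ω, 0 < φ x)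
    {z : F} (hz : z ∈ Ω) : HasFDerivAt (fun z => Real.log (φ z)) (UU1 φ P z) z :=
  (h.at1 ho hz).log (hpos z hz).ne'

lemma UU2_deriv (h : TwoD (closure Ω) φ P Q) (ho : IsOpen Ω) (hpos : ∀ x ∈ Ω, 0 < φ x)
    {z : F} (hz : z ∈ Ω) : HasFDerivAt (UU1 φ P) (UU2 φ P Q z) z := by
  have h1 : HasFDerivAt (fun z => (φ z)⁻¹) (-((φ z) ^ 2)⁻¹ • P z) z := by
    have := (hasDerivAt_inv (hpos z hz).ne').comp_hasFDerivAt z (h.at1 ho hz)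
    exact this
  have h2 := h1.smul (h.at2 ho hz)
  refine h2.congr_fderiv ?_
  ext v w
  simp [UU2]
  ring

lemma UU2_cont (h : TwoD (closure Ω) φ P Q) (ho : IsOpen Ω) (hpos : ∀ x ∈ Ω, 0 < φ x) :
    ContinuousOn (UU2 φ P Q) Ω := by
  have c0 : ContinuousOn φ Ω := fun z hz => (h.at1 ho hz).continuousAt.continuousWithinAt
  have c1 : ContinuousOn P Ω := fun z hz => (h.at2 ho hz).continuousAt.continuousWithinAt
  have c2 : ContinuousOn Q Ω := h.c2.mono subset_closure
  have ci : ContinuousOn (fun z => (φ z)⁻¹) Ω := c0.inv₀ fun z hz => (hpos z hz).ne'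
  have c3 : ContinuousOn (fun z => (P z).smulRight (P z)) Ω := by
    have : Continuous (fun l : F →L[ℝ] ℝ => l.smulRight l) := by
      have := (ContinuousLinearMap.smulRightL ℝ F (F →L[ℝ] ℝ)).continuous
      exact this.clm_apply continuous_id
    exact this.comp_continuousOn c1
  exact (ci.smul c2).sub ((ci.pow 2).smul c3)

lemma UU2_symm (h : TwoD (closure Ω) φ P Q) (ho : IsOpen Ω)
    {z : F} (hz : z ∈ Ω) (v w : F) : UU2 φ P Q z v w = UU2 φ P Q z w v := by
  have := second_derivative_symmetric_of_eventually
    (f := φ) (f' := P) (f'' := Q z) (x := z)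
    (by filter_upwards [ho.mem_nhds hz] with y hy using h.at1 ho hy) (h.at2 ho hz) v w
  rw [UU2_apply, UU2_apply, this, mul_comm (P z v)]

lemma UU2_trace (b : OrthonormalBasis ι ℝ F) {q : F → ℝ} {lam : ℝ} (hpos : ∀ x ∈ Ω, 0 < φ x)
    (heq : ∀ x ∈ Ω, ∑ i, Q x (b i) (b i) - q x * φ x = - lam * φ x) {z : F} (hz : z ∈ Ω) :
    ∑ i, UU2 φ P Q z (b i) (b i) = q z - lam - ∑ i, (UU1 φ P z (b i)) ^ 2 := by
  simp only [UU2_apply, UU1, smul_apply, smul_eq_mul, Finset.sum_sub_distrib]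
  rw [← Finset.mul_sum]
  have h1 := heq z hz
  have h2 := hpos z hz
  have h3 : ∑ i, Q z (b i) (b i) = (q z - lam) * φ z := by linarith
  rw [h3]
  congr 1
  · field_simp
  · exact Finset.sum_congr rfl fun i _ => by ring

lemma UU2_bound (g : Geo Ω ρ) (h : TwoD (closure Ω) φ P Q) (hpos : ∀ x ∈ Ω, 0 < φ x)
    (hbd : ∀ x ∈ frontier Ω, φ x = 0)
    (hν : ∀ x ∈ frontier Ω, P x (gradient ρ x) < 0) {x : F} (hx : x ∈ closure Ω) :
    ∃ C : ℝ, 0 ≤ C ∧ ∀ᶠ z in 𝓝 x, z ∈ Ω → ∀ v, UU2 φ P Q z v v ≤ C * ‖v‖ ^ 2 := by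
  rcases g.mem_or hx with hx | hx
  · refine ⟨‖UU2 φ P Q x‖ + 1, by positivity, ?_⟩
    have hc := ((UU2_cont h g.isOpen hpos).continuousAt (g.isOpen.mem_nhds hx)).norm
    filter_upwards [hc.eventually (gt_mem_nhds (lt_add_one _))] with z hz _ v
    calc UU2 φ P Q z v v ≤ ‖UU2 φ P Q z v v‖ := le_abs_self _
      _ ≤ ‖UU2 φ P Q z‖ * ‖v‖ * ‖v‖ := (UU2 φ P Q z).le_opNorm₂ v v
      _ ≤ (‖UU2 φ P Q x‖ + 1) * ‖v‖ * ‖v‖ := by gcongr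
      _ = _ := by ring
  · refine ⟨0, le_rfl, ?_⟩
    filter_upwards [g.concave_near h hpos hbd hν hx] with z hz hzΩ v
    have h1 := hz hzΩ v
    have h2 := hpos z hzΩ
    rw [UU2_apply, zero_mul, sub_nonpos]
    field_simp
    linarith

lemma UU1_mono (g : Geo Ω ρ) (h : TwoD (closure Ω) φ P Q) (hpos : ∀ x ∈ Ω, 0 < φ x)
    (hbd : ∀ x ∈ frontier Ω, φ x = 0)
    (hν : ∀ x ∈ frontier Ω, P x (gradient ρ x) < 0) {x : F} (hx : x ∈ closure Ω) :
    ∃ C : ℝ, 0 ≤ C ∧ ∀ᶠ p : F × F in 𝓝 (x, x), p.1 ∈ Ω → p.2 ∈ Ω →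
      (UU1 φ P p.2 - UU1 φ P p.1) (p.2 - p.1) ≤ C * ‖p.2 - p.1‖ ^ 2 := by
  obtain ⟨C, hC, hev⟩ := UU2_bound g h hpos hbd hν hx
  refine ⟨C, hC, ?_⟩
  obtain ⟨r, hr, hball⟩ := Metric.eventually_nhds_iff_ball.1 hev
  have h1 : Metric.ball x r ×ˢ Metric.ball x r ∈ 𝓝 (x, x) :=
    prod_mem_nhds (Metric.ball_mem_nhds x hr) (Metric.ball_mem_nhds x hr)
  filter_upwards [h1] with p hp h1Ω h2Ω
  have hseg : ∀ t ∈ Icc (0:ℝ) 1, p.1 + t • (p.2 - p.1) ∈ Ω ∧ p.1 + t • (p.2 - p.1) ∈ Metric.ball x r :=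
    fun t ht => ⟨g.convΩ.add_smul_sub_mem h1Ω h2Ω ht, (convex_ball x r).add_smul_sub_mem hp.1 hp.2 ht⟩
  have hd : ∀ t ∈ Icc (0:ℝ) 1, HasDerivAt (fun t : ℝ => UU1 φ P (p.1 + t • (p.2 - p.1)) (p.2 - p.1))
      (UU2 φ P Q (p.1 + t • (p.2 - p.1)) (p.2 - p.1) (p.2 - p.1)) t := by
    intro t ht
    have h1 : HasDerivAt (fun t : ℝ => UU1 φ P (p.1 + t • (p.2 - p.1)))
        (UU2 φ P Q (p.1 + t • (p.2 - p.1)) (p.2 - p.1)) t :=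
      HasFDerivAt.comp_hasDerivAt t (UU2_deriv h g.isOpen hpos (hseg t ht).1)
        (hasDerivAt_line p.1 (p.2 - p.1) t)
    refine (h1.clm_apply (hasDerivAt_const t (p.2 - p.1))).congr_deriv ?_
    simp
  obtain ⟨t, ht, hte⟩ := exists_hasDerivAt_eq_slope
    (fun t : ℝ => UU1 φ P (p.1 + t • (p.2 - p.1)) (p.2 - p.1))
    (fun t : ℝ => UU2 φ P Q (p.1 + t • (p.2 - p.1)) (p.2 - p.1) (p.2 - p.1)) (zero_lt_one (α := ℝ))
    (fun s hs => (hd s hs).continuousAt.continuousWithinAt)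
    (fun s hs => hd s ⟨hs.1.le, hs.2.le⟩)
  have := hball _ (hseg t ⟨ht.1.le, ht.2.le⟩).2 (hseg t ⟨ht.1.le, ht.2.le⟩).1 (p.2 - p.1)
  rw [hte] at this
  simpa using this

lemma N_atTop (g : Geo Ω ρ) (h : TwoD (closure Ω) φ P Q) (hpos : ∀ x ∈ Ω, 0 < φ x)
    (hbd : ∀ x ∈ frontier Ω, φ x = 0)
    (hν : ∀ x ∈ frontier Ω, P x (gradient ρ x) < 0) {x y : F} (hx : x ∈ frontier Ω)
    (hy : y ∈ closure Ω) (hxy : x ≠ y) :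
    Tendsto (fun p : F × F => UU1 φ P p.1 (p.2 - p.1)) (𝓝[Ω ×ˢ Ω] (x, y)) atTop := by
  have hxK := g.closed_mem hx
  obtain ⟨c, hc, hPc⟩ := g.P_eq h hpos hbd hν hx
  have hP : 0 < P x (y - x) := by
    rw [hPc]
    have := g.strict hx hy hxy.symm
    nlinarith
  have t1 : Tendsto (fun p : F × F => p.1) (𝓝[Ω ×ˢ Ω] (x, y)) (𝓝[Ω] x) := by
    refine tendsto_nhdsWithin_iff.2 ⟨?_, ?_⟩
    · exact (continuous_fst.tendsto (x, y)).mono_left nhdsWithin_le_nhds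
    · filter_upwards [self_mem_nhdsWithin] with p hp using hp.1
  have t2 : Tendsto φ (𝓝[Ω] x) (𝓝[>] 0) := by
    refine tendsto_nhdsWithin_iff.2 ⟨?_, ?_⟩
    · have := (h.d1 x hxK).continuousWithinAt.mono subset_closure
      rw [← hbd x hx]; exact this
    · filter_upwards [self_mem_nhdsWithin] with p hp using hpos p hp
  have t3 := tendsto_inv_nhdsGT_zero.comp (t2.comp t1)
  have t4 : Tendsto (fun p : F × F => P p.1) (𝓝[Ω ×ˢ Ω] (x, y)) (𝓝 (P x)) :=
    ((h.d2 x hxK).continuousWithinAt.mono subset_closure).tendsto.comp t1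
  have t5 : Tendsto (fun p : F × F => p.2 - p.1) (𝓝[Ω ×ˢ Ω] (x, y)) (𝓝 (y - x)) := by
    have : Continuous (fun p : F × F => p.2 - p.1) := by fun_prop
    exact (this.tendsto (x, y)).mono_left nhdsWithin_le_nhds
  have t6 := tendsto_clm_ap t4 t5
  exact t3.atTop_mul_pos hP t6

lemma M_bdd (g : Geo Ω ρ) (h : TwoD (closure Ω) φ P Q) (hpos : ∀ x ∈ Ω, 0 < φ x)
    (hbd : ∀ x ∈ frontier Ω, φ x = 0)
    (hν : ∀ x ∈ frontier Ω, P x (gradient ρ x) < 0) {x y : F} (hx : x ∈ closure Ω)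
    (hy : y ∈ closure Ω) (hxy : x ≠ y) :
    ∃ B : ℝ, ∀ᶠ p : F × F in 𝓝[Ω ×ˢ Ω] (x, y), B ≤ UU1 φ P p.1 (p.2 - p.1) := by
  rcases g.mem_or hx with hx | hx
  · have t1 : Tendsto (fun p : F × F => UU1 φ P p.1) (𝓝 (x, y)) (𝓝 (UU1 φ P x)) :=
      (UU2_deriv h g.isOpen hpos hx).continuousAt.tendsto.comp (continuous_fst.tendsto (x, y))
    have t5 : Tendsto (fun p : F × F => p.2 - p.1) (𝓝 (x, y)) (𝓝 (y - x)) := by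
      have : Continuous (fun p : F × F => p.2 - p.1) := by fun_prop
      exact this.tendsto (x, y)
    refine ⟨UU1 φ P x (y - x) - 1, ?_⟩
    exact ((tendsto_clm_ap t1 t5).eventually (le_mem_nhds (sub_one_lt _))).filter_mono nhdsWithin_le_nhds
  · exact ⟨0, (N_atTop g h hpos hbd hν hx hy hxy).eventually_ge_atTop 0⟩

lemma Z_bdry (g : Geo Ω ρ) (h : TwoD (closure Ω) φ P Q) (hpos : ∀ x ∈ Ω, 0 < φ x)
    (hbd : ∀ x ∈ frontier Ω, φ x = 0)
    (hν : ∀ x ∈ frontier Ω, P x (gradient ρ x) < 0) {x y : F} (hx : x ∈ frontier Ω)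
    (hy : y ∈ closure Ω) (hxy : x ≠ y) {ψ : ℝ → ℝ} (hψ : ContinuousAt ψ (‖y - x‖ / 2)) (m : ℝ) :
    ∀ᶠ p : F × F in 𝓝[Ω ×ˢ Ω] (x, y), Zf (UU1 φ P) ψ p < m := by
  obtain ⟨B, hB⟩ := M_bdd g h hpos hbd hν hy (g.closed_mem hx) hxy.symm
  have hsw : Tendsto (Prod.swap : F × F → F × F) (𝓝[Ω ×ˢ Ω] (x, y)) (𝓝[Ω ×ˢ Ω] (y, x)) := by
    refine tendsto_nhdsWithin_iff.2 ⟨?_, ?_⟩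
    · exact (continuous_swap.tendsto (x, y)).mono_left nhdsWithin_le_nhds
    · filter_upwards [self_mem_nhdsWithin] with p hp using ⟨hp.2, hp.1⟩
  have hB' := hsw.eventually hB
  have t1 := tendsto_atTop_add_right_of_le' _ B (N_atTop g h hpos hbd hν hx hy hxy) hB'
  have tn : Tendsto (fun p : F × F => ‖p.2 - p.1‖) (𝓝[Ω ×ˢ Ω] (x, y)) (𝓝 ‖y - x‖) := by
    have : Continuous (fun p : F × F => ‖p.2 - p.1‖) := by fun_prop
    exact (this.tendsto (x, y)).mono_left nhdsWithin_le_nhds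
  have hd : 0 < ‖y - x‖ := norm_pos_iff.2 (sub_ne_zero.2 hxy.symm)
  have t2 := t1.atTop_mul_pos (inv_pos.2 hd) (tn.inv₀ hd.ne')
  have t3 : Tendsto (fun p : F × F => 2 * ψ (‖p.2 - p.1‖ / 2)) (𝓝[Ω ×ˢ Ω] (x, y))
      (𝓝 (2 * ψ (‖y - x‖ / 2))) := (hψ.tendsto.comp (tn.div_const 2)).const_mul 2
  have t4 := t2.atTop_add t3
  filter_upwards [t4.eventually_gt_atTop (-m)] with p hp
  have : Zf (UU1 φ P) ψ p = - ((UU1 φ P p.1 (p.2 - p.1) + UU1 φ P p.swap.1 (p.swap.2 - p.swap.1))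
      * ‖p.2 - p.1‖⁻¹ + 2 * ψ (‖p.2 - p.1‖ / 2)) := by
    simp only [Zf, Prod.fst_swap, Prod.snd_swap]
    rw [← neg_sub p.2 p.1, sub_apply]
    simp only [map_neg]
    ring
  rw [this]
  linarith

lemma Z_diag (g : Geo Ω ρ) (h : TwoD (closure Ω) φ P Q) (hpos : ∀ x ∈ Ω, 0 < φ x)
    (hbd : ∀ x ∈ frontier Ω, φ x = 0)
    (hν : ∀ x ∈ frontier Ω, P x (gradient ρ x) < 0) {x : F} (hx : x ∈ closure Ω)
    {ψ : ℝ → ℝ} (hψ : ContinuousAt ψ 0) (hψ0 : ψ 0 = 0) {m : ℝ} (hm : 0 < m) :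
    ∀ᶠ p : F × F in 𝓝 (x, x), p.1 ∈ Ω → p.2 ∈ Ω → p.1 ≠ p.2 → Zf (UU1 φ P) ψ p < m := by
  obtain ⟨C, hC, hev⟩ := UU1_mono g h hpos hbd hν hx
  have tn : Tendsto (fun p : F × F => ‖p.2 - p.1‖) (𝓝 (x, x)) (𝓝 0) := by
    have : Continuous (fun p : F × F => ‖p.2 - p.1‖) := by fun_prop
    simpa using this.tendsto (x, x)
  have hψ' : Tendsto ψ (𝓝 (0 / 2)) (𝓝 0) := by
    have := hψ.tendsto
    rw [hψ0] at this
    simpa using this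
  have t : Tendsto (fun p : F × F => C * ‖p.2 - p.1‖ - 2 * ψ (‖p.2 - p.1‖ / 2)) (𝓝 (x, x)) (𝓝 0) := by
    have := (tn.const_mul C).sub ((hψ'.comp (tn.div_const 2)).const_mul 2)
    simpa using this
  filter_upwards [hev, t.eventually (gt_mem_nhds hm)] with p hp1 hp2 h1 h2 hne
  have hd : 0 < ‖p.2 - p.1‖ := norm_pos_iff.2 (sub_ne_zero.2 hne.symm)
  have := hp1 h1 h2
  refine lt_of_le_of_lt ?_ hp2
  simp only [Zf]
  gcongr
  rw [div_le_iff₀ hd]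
  linarith

/-- Step 1 : log-concavity comparison -/
lemma Z_le (b : OrthonormalBasis ι ℝ F) (g : Geo Ω ρ) (h : TwoD (closure Ω) φ P Q)
    (hpos : ∀ x ∈ Ω, 0 < φ x) (hbd : ∀ x ∈ frontier Ω, φ x = 0)
    (hν : ∀ x ∈ frontier Ω, P x (gradient ρ x) < 0)
    {q : F → ℝ} {q1 : F → F →L[ℝ] ℝ} {lam : ℝ}
    (hq1 : ∀ x ∈ Ω, HasStrictFDerivAt q (q1 x) x)
    (hqm : ∀ x ∈ Ω, ∀ y ∈ Ω, 0 ≤ (q1 y - q1 x) (y - x))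
    (heq : ∀ x ∈ Ω, ∑ i, Q x (b i) (b i) - q x * φ x = - lam * φ x)
    {T : ℝ} {G0 ψ ψ1 ψ2 : ℝ → ℝ} (hΨ : Psi T G0 ψ ψ1 ψ2)
    (hT : ∀ x ∈ closure Ω, ∀ y ∈ closure Ω, ‖y - x‖ / 2 < T)
    {x y : F} (hx : x ∈ Ω) (hy : y ∈ Ω) (hxy : x ≠ y) : Zf (UU1 φ P) ψ (x, y) ≤ 0 := by
  by_contra hcon
  push Not at hcon
  set Z := Zf (UU1 φ P) ψ with hZ
  set m := Z (x, y) with hm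
  have hIoo : ∀ x ∈ closure Ω, ∀ y ∈ closure Ω, ‖y - x‖ / 2 ∈ Ioo (-T) T := fun x hx y hy =>
    ⟨by have := hΨ.pos; have := norm_nonneg (y - x); linarith, hT x hx y hy⟩
  set S : Set (F × F) := {p | p.1 ∈ Ω ∧ p.2 ∈ Ω ∧ p.1 ≠ p.2 ∧ m ≤ Z p} with hS
  have hnbd : ∀ p : F × F, p.1 ∈ Ω → p.2 ∈ Ω → p.1 ≠ p.2 →
      ∀ᶠ p' in 𝓝 p, p'.1 ∈ Ω ∧ p'.2 ∈ Ω ∧ p'.1 ≠ p'.2 := by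
    intro p h1 h2 h3
    exact (continuousAt_fst.eventually (g.isOpen.mem_nhds h1)).and
      ((continuousAt_snd.eventually (g.isOpen.mem_nhds h2)).and
        ((isOpen_ne_fun continuous_fst continuous_snd).mem_nhds h3))
  have hZc : ∀ p : F × F, p.1 ∈ Ω → p.2 ∈ Ω → p.1 ≠ p.2 → ContinuousAt Z p := by
    intro p h1 h2 h3
    have hd : ‖p.2 - p.1‖ ≠ 0 := norm_ne_zero_iff.2 (sub_ne_zero.2 h3.symm)
    have c1 : ContinuousAt (fun p : F × F => UU1 φ P p.1) p :=
      ContinuousAt.comp (g := UU1 φ P) (UU2_deriv h g.isOpen hpos h1).continuousAt continuousAt_fst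
    have c2 : ContinuousAt (fun p : F × F => UU1 φ P p.2) p :=
      ContinuousAt.comp (g := UU1 φ P) (UU2_deriv h g.isOpen hpos h2).continuousAt continuousAt_snd
    have c3 : ContinuousAt (fun p : F × F => ψ (‖p.2 - p.1‖ / 2)) p :=
      ContinuousAt.comp (g := ψ) (hΨ.dψ _ (hIoo _ (subset_closure h1) _ (subset_closure h2))).continuousAt
        (by fun_prop)
    have c4 : ContinuousAt (fun p : F × F => p.2 - p.1) p := by fun_prop
    exact (((c2.sub c1).clm_apply c4).div c4.norm hd).sub (continuousAt_const.mul c3)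
  have hout : ∀ p : F × F, p.1 ∈ closure Ω → p.2 ∈ closure Ω → p ∉ S → ∀ᶠ p' in 𝓝 p, p' ∉ S := by
    rintro ⟨x', y'⟩ h1 h2 hp
    simp only at h1 h2
    by_cases hne : x' = y'
    · subst hne
      have h0 : (0:ℝ) ∈ Ioo (-T) T := ⟨by linarith [hΨ.pos], hΨ.pos⟩
      filter_upwards [Z_diag g h hpos hbd hν h1 (hΨ.dψ 0 h0).continuousAt hΨ.zero hcon] with p' hp' hS'
      exact absurd (hp' hS'.1 hS'.2.1 hS'.2.2.1) (not_lt.2 hS'.2.2.2)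
    rcases g.mem_or h1 with h1' | h1'
    · rcases g.mem_or h2 with h2' | h2'
      · have hlt : Z (x', y') < m := by
          by_contra hh
          exact hp ⟨h1', h2', hne, not_lt.1 hh⟩
        filter_upwards [(hZc (x', y') h1' h2' hne).eventually (gt_mem_nhds hlt)] with p' hp' hS'
        exact absurd hp' (not_lt.2 hS'.2.2.2)
      · have hc := (hΨ.dψ _ (hIoo y' h2 x' h1)).continuousAt
        have := Z_bdry g h hpos hbd hν h2' h1 (Ne.symm hne) hc m
        rw [eventually_nhdsWithin_iff] at this
        have hsw : Tendsto (Prod.swap : F × F → F × F) (𝓝 (x', y')) (𝓝 (y', x')) :=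
          continuous_swap.tendsto (x', y')
        filter_upwards [hsw.eventually this] with p' hp' hS'
        have := hp' ⟨hS'.2.1, hS'.1⟩
        rw [Zf_swap] at this
        exact absurd this (not_lt.2 hS'.2.2.2)
    · have hc := (hΨ.dψ _ (hIoo x' h1 y' h2)).continuousAt
      have := Z_bdry g h hpos hbd hν h1' h2 hne hc m
      rw [eventually_nhdsWithin_iff] at this
      filter_upwards [this] with p' hp' hS'
      exact absurd (hp' ⟨hS'.1, hS'.2.1⟩) (not_lt.2 hS'.2.2.2)
  have hSK : S ⊆ closure Ω ×ˢ closure Ω := fun p hp => ⟨subset_closure hp.1, subset_closure hp.2.1⟩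
  have hcK : IsCompact (closure Ω ×ˢ closure Ω) := g.bdd.isCompact_closure.prod g.bdd.isCompact_closure
  have hScl : IsClosed S := by
    rw [← closure_subset_iff_isClosed]
    intro p hp
    by_contra hpS
    have hpK := closure_minimal hSK hcK.isClosed hp
    exact mem_closure_iff_frequently.1 hp (hout p hpK.1 hpK.2 hpS)
  have hScomp : IsCompact S := hcK.of_isClosed_subset hScl hSK
  obtain ⟨p, hpS, hpmax⟩ := hScomp.exists_isMaxOn ⟨(x, y), hx, hy, hxy, le_rfl⟩
    (fun p hp => (hZc p hp.1 hp.2.1 hp.2.2.1).continuousWithinAt)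
  have hloc : IsLocalMax Z p := by
    filter_upwards [hnbd p hpS.1 hpS.2.1 hpS.2.2.1] with p' hp'
    by_cases hle : m ≤ Z p'
    · exact hpmax ⟨hp'.1, hp'.2.1, hp'.2.2, hle⟩
    · exact (not_le.1 hle).le.trans hpS.2.2.2
  obtain ⟨x', y'⟩ := p
  have hI := hIoo x' (subset_closure hpS.1) y' (subset_closure hpS.2.1)
  have hIn := Ioo_mem_nhds hI.1 hI.2
  have := Z_max b g.isOpen (fun z hz => UU1_deriv h g.isOpen hpos hz)
    (fun z hz => UU2_deriv h g.isOpen hpos hz) (UU2_cont h g.isOpen hpos)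
    (fun z hz v w => UU2_symm h g.isOpen hz v w) hq1 hqm
    (fun z hz => UU2_trace b hpos heq hz) hpS.1 hpS.2.1 hpS.2.2.1
    (by filter_upwards [hIn] with z hz using hΨ.dG z hz)
    (by filter_upwards [hIn] with z hz using hΨ.dψ z hz)
    (hΨ.dψ1 _ hI) (hΨ.ode _ hI) (hΨ.neg _ hI) hloc
  exact absurd (hcon.trans_le hpS.2.2.2) (not_lt.2 this)
end U
end

section
set_option linter.unusedSectionVars false
set_option maxSynthPendingDepth 3
open Filter Topology
variable {F : Type*} [NormedAddCommGroup F] [InnerProductSpace ℝ F] [FiniteDimensional ℝ F]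
variable {ι : Type*} [Fintype ι]

lemma norm_fd {z x : F} (hzx : z ≠ x) :
    ∃ N : F →L[ℝ] ℝ, HasFDerivAt (fun z => ‖z - x‖) N z ∧ ∀ v, N v = ⟪z - x, v⟫ / ‖z - x‖ := by
  have hw : z - x ≠ 0 := sub_ne_zero.2 hzx
  have hd : DifferentiableAt ℝ (fun z : F => ‖z - x‖) z :=
    DifferentiableAt.norm ℝ (by fun_prop) hw
  refine ⟨_, hd.hasFDerivAt, fun v => ?_⟩
  have h1 : HasFDerivAt (fun z : F => ‖z - x‖) (fderiv ℝ (fun z : F => ‖z - x‖) z) (z + (0:ℝ) • v) := by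
    rw [zero_smul, add_zero]; exact hd.hasFDerivAt
  have h2 := h1.comp_hasDerivAt (0:ℝ) (hasDerivAt_line z v 0)
  have h3 := hasDerivAt_norm_line hw v
  refine h2.unique (h3.congr_of_eventuallyEq (Eventually.of_forall fun t => ?_))
  simp only [Function.comp]
  rw [add_sub_right_comm]

lemma bdry_contra {Ω : Set F} {ρ : F → ℝ} (g : Geo Ω ρ) {w : F → ℝ} {w1 : F →L[ℝ] ℝ} {x y : F}
    (hy : y ∈ frontier Ω) (hx : x ∈ closure Ω) (hxy : x ≠ y)
    (hw : HasFDerivWithinAt w w1 (closure Ω) y) (hν : w1 (gradient ρ y) = 0)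
    {η : ℝ → ℝ} {η1 m : ℝ} (hη : HasDerivAt η η1 (‖y - x‖ / 2)) (hη1 : 0 < η1) (hm : 0 < m)
    (hmax : ∀ z ∈ closure Ω, w z - m * η (‖z - x‖ / 2) ≤ w y - m * η (‖y - x‖ / 2)) : False := by
  obtain ⟨N, hN, hNv⟩ := norm_fd hxy.symm
  have hN2 : HasFDerivAt (fun z => ‖z - x‖ / 2) ((2:ℝ)⁻¹ • N) y := by
    have := hN.const_smul (2:ℝ)⁻¹
    refine this.congr_of_eventuallyEq (Eventually.of_forall fun z => ?_)
    simp [div_eq_inv_mul]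
  have h1 := (hη.comp_hasFDerivAt y hN2).const_smul m
  have h2 := hw.sub h1.hasFDerivWithinAt
  have hmx : IsMaxOn (fun z => w z - m * η (‖z - x‖ / 2)) (closure Ω) y := fun z hz => hmax z hz
  have hlt : fderiv ℝ ρ y (- gradient ρ y) < 0 := by
    rw [map_neg]; linarith [g.rho_grad_pos hy]
  have h3 := hmx.localize.hasFDerivWithinAt_nonpos h2 (g.inward_tangent hy hlt)
  have h4 := g.strict hy hx hxy
  rw [← inner_gradient_left, ← neg_sub, inner_neg_right, real_inner_comm] at h4
  have hd : 0 < ‖y - x‖ := norm_pos_iff.2 (sub_ne_zero.2 hxy.symm)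
  simp only [sub_apply, smul_apply, map_neg, hν, hNv, smul_eq_mul] at h3
  have : 0 < m * (η1 * (2⁻¹ * (⟪y - x, gradient ρ y⟫ / ‖y - x‖))) := by
    have : 0 < ⟪y - x, gradient ρ y⟫ := by linarith
    positivity
  linarith

lemma fo_w {Ω : Set F} (ho : IsOpen Ω) {w : F → ℝ} {w1 : F →L[ℝ] ℝ} {x y e : F} {d : ℝ}
    (hy : y ∈ Ω) (hd0 : 0 < d) (he : ‖e‖ = 1) (hyx : y - x = d • e)
    (hw : HasFDerivAt w w1 y) {η : ℝ → ℝ} {η1 m : ℝ} (hη : HasDerivAt η η1 (d / 2))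
    (hmax : ∀ z ∈ Ω, w z - m * η (‖z - x‖ / 2) ≤ w y - m * η (‖y - x‖ / 2)) (v : F) :
    w1 v = m * η1 / 2 * ⟪e, v⟫ := by
  have hd : ‖y - x‖ = d := by rw [hyx, norm_smul, he, Real.norm_of_nonneg hd0.le, mul_one]
  have hxy : y ≠ x := by
    rintro rfl
    simp at hd; exact hd0.ne hd
  obtain ⟨N, hN, hNv⟩ := norm_fd hxy
  have hN2 : HasFDerivAt (fun z => ‖z - x‖ / 2) ((2:ℝ)⁻¹ • N) y := by
    have := hN.const_smul (2:ℝ)⁻¹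
    refine this.congr_of_eventuallyEq (Eventually.of_forall fun z => ?_)
    simp [div_eq_inv_mul]
  rw [← hd] at hη
  have h1 := (hη.comp_hasFDerivAt y hN2).const_smul m
  have h2 := hw.sub h1
  have hmx : IsLocalMax (fun z => w z - m * η (‖z - x‖ / 2)) y := by
    filter_upwards [ho.mem_nhds hy] with z hz using hmax z hz
  have h3 := congrArg (fun l : F →L[ℝ] ℝ => l v) (hmx.hasFDerivAt_eq_zero h2)
  simp only [sub_apply, smul_apply, hNv, smul_eq_mul, zero_apply] at h3
  have hin : ⟪y - x, v⟫ / ‖y - x‖ = ⟪e, v⟫ := by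
    rw [hd, hyx, inner_smul_left]
    simp
    field_simp
  rw [hin] at h3
  linarith

lemma so_w {Ω : Set F} (ho : IsOpen Ω) {w : F → ℝ} {w1 : F → F →L[ℝ] ℝ}
    {w2 : F → F →L[ℝ] F →L[ℝ] ℝ}
    (hw1 : ∀ z ∈ Ω, HasFDerivAt w (w1 z) z) (hw2 : ∀ z ∈ Ω, HasFDerivAt w1 (w2 z) z)
    {x y e : F} {d : ℝ}
    (hx : x ∈ Ω) (hy : y ∈ Ω) (hd0 : 0 < d) (he : ‖e‖ = 1) (hyx : y - x = d • e)
    {η η1 : ℝ → ℝ} {η2 m : ℝ}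
    (hη : ∀ᶠ z in 𝓝 (d / 2), HasDerivAt η (η1 z) z) (hη1 : HasDerivAt η1 η2 (d / 2))
    (hle : ∀ x' ∈ Ω, ∀ y' ∈ Ω, w y' - w x' ≤ m * η (‖y' - x'‖ / 2))
    (h0 : w y - w x = m * η (d / 2)) (c : F) :
    w2 y (refl_e e c) (refl_e e c) - w2 x c c - m * (η2 * ⟪e, c⟫ ^ 2) ≤ 0 := by
  set R := refl_e e with hR
  have hlin : ∀ z u : F, Tendsto (fun t : ℝ => z + t • u) (𝓝 0) (𝓝 z) := by
    intro z u
    have : Continuous (fun t : ℝ => z + t • u) := by fun_prop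
    simpa using this.tendsto 0
  have hcd : Tendsto (fun t : ℝ => d / 2 - t * ⟪e, c⟫) (𝓝 0) (𝓝 (d / 2)) := by
    have : Continuous (fun t : ℝ => d / 2 - t * ⟪e, c⟫) := by fun_prop
    simpa using this.tendsto 0
  have hdl : ∀ t : ℝ, HasDerivAt (fun t : ℝ => d / 2 - t * ⟪e, c⟫) (-⟪e, c⟫) t := by
    intro t
    simpa using ((hasDerivAt_id t).mul_const ⟪e, c⟫).const_sub (d / 2)
  refine second_deriv_nonpos
    (F := fun t => w (y + t • R c) - w (x + t • c) - m * η (d / 2 - t * ⟪e, c⟫))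
    (F' := fun t => w1 (y + t • R c) (R c) - w1 (x + t • c) c - m * (η1 (d / 2 - t * ⟪e, c⟫) * (-⟪e, c⟫))) ?_ ?_ ?_
  · filter_upwards [(hlin y (R c)).eventually (ho.mem_nhds hy), (hlin x c).eventually (ho.mem_nhds hx),
      hcd.eventually hη] with t h1 h2 h3
    have a1 : HasDerivAt (fun t : ℝ => w (y + t • R c)) (w1 (y + t • R c) (R c)) t :=
      HasFDerivAt.comp_hasDerivAt t (hw1 _ h1) (hasDerivAt_line y (R c) t)
    have a2 : HasDerivAt (fun t : ℝ => w (x + t • c)) (w1 (x + t • c) c) t :=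
      HasFDerivAt.comp_hasDerivAt t (hw1 _ h2) (hasDerivAt_line x c t)
    have a3 : HasDerivAt (fun t : ℝ => η (d / 2 - t * ⟪e, c⟫)) (η1 (d / 2 - t * ⟪e, c⟫) * (-⟪e, c⟫)) t :=
      HasDerivAt.comp t h3 (hdl t)
    exact (a1.sub a2).sub (a3.const_mul m)
  · have a1 : HasDerivAt (fun t : ℝ => w1 (y + t • R c)) (w2 y (R c)) 0 :=
      HasFDerivAt.comp_hasDerivAt (0:ℝ) (by simpa using hw2 _ hy) (hasDerivAt_line y (R c) 0)
    have a2 : HasDerivAt (fun t : ℝ => w1 (x + t • c)) (w2 x c) 0 :=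
      HasFDerivAt.comp_hasDerivAt (0:ℝ) (by simpa using hw2 _ hx) (hasDerivAt_line x c 0)
    have a3 : HasDerivAt (fun t : ℝ => η1 (d / 2 - t * ⟪e, c⟫)) (η2 * (-⟪e, c⟫)) 0 :=
      HasDerivAt.comp (0:ℝ) (by simpa using hη1) (hdl 0)
    refine (((a1.clm_apply (hasDerivAt_const (0:ℝ) (R c))).sub
      (a2.clm_apply (hasDerivAt_const (0:ℝ) c))).sub ((a3.mul_const (-⟪e, c⟫)).const_mul m)).congr_deriv ?_
    simp only [map_zero, add_zero]
    ring
  · filter_upwards [(hlin y (R c)).eventually (ho.mem_nhds hy), (hlin x c).eventually (ho.mem_nhds hx),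
      hcd.eventually (lt_mem_nhds (show 0 < d / 2 by positivity))] with t h1 h2 h3
    have hk := hle _ h2 _ h1
    have e1 : y + t • R c - (x + t • c) = (2 * (d / 2 - t * ⟪e, c⟫)) • e := by
      calc y + t • R c - (x + t • c) = (y - x) + t • (R c - c) := by module
        _ = _ := by rw [hyx, hR, refl_e_apply]; module
    rw [e1, norm_smul, he, mul_one, Real.norm_of_nonneg (by linarith), mul_div_cancel_left₀ _ two_ne_zero] at hk
    simp only [zero_smul, add_zero, zero_mul, sub_zero]
    linarith

/-- Step 2 -/
lemma gap_bound (b : OrthonormalBasis ι ℝ F) {Ω : Set F} {ρ : F → ℝ} (g : Geo Ω ρ)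
    {w : F → ℝ} {w1 : F → F →L[ℝ] ℝ} {w2 : F → F →L[ℝ] F →L[ℝ] ℝ}
    (h : TwoD (closure Ω) w w1 w2)
    (hν : ∀ x ∈ frontier Ω, w1 x (gradient ρ x) = 0)
    {U1 : F → F →L[ℝ] ℝ} {ψ : ℝ → ℝ}
    (hZ : ∀ x ∈ Ω, ∀ y ∈ Ω, x ≠ y → Zf U1 ψ (x, y) ≤ 0) {μ κ : ℝ}
    (heq : ∀ x ∈ Ω, ∑ i, w2 x (b i) (b i) + 2 * ∑ i, U1 x (b i) * w1 x (b i) = - μ * w x)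
    (hnc : ∃ x ∈ closure Ω, ∃ y ∈ closure Ω, w x < w y)
    {I : Set ℝ} (hI : IsOpen I) (hIK : ∀ x ∈ closure Ω, ∀ y ∈ closure Ω, ‖y - x‖ / 2 ∈ I)
    {η η1 η2 : ℝ → ℝ} (hη : ∀ z ∈ I, HasDerivAt η (η1 z) z) (hη1 : ∀ z ∈ I, HasDerivAt η1 (η2 z) z)
    (hηp : ∀ x ∈ closure Ω, ∀ y ∈ closure Ω, 0 < η (‖y - x‖ / 2))
    (hηposq : ∀ x ∈ closure Ω, ∀ y ∈ closure Ω, 0 < η1 (‖y - x‖ / 2))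
    (hode : ∀ z ∈ I, η2 z + 2 * ψ z * η1 z + κ * η z = 0) : κ ≤ μ := by
  have ho := g.isOpen
  have hcK : IsCompact (closure Ω ×ˢ closure Ω) := g.bdd.isCompact_closure.prod g.bdd.isCompact_closure
  have hwc : ContinuousOn w (closure Ω) := fun z hz => (h.d1 z hz).continuousWithinAt
  obtain ⟨x0, hx0, y0, hy0, hlt⟩ := hnc
  have hc : ContinuousOn (fun p : F × F => (w p.2 - w p.1) / η (‖p.2 - p.1‖ / 2)) (closure Ω ×ˢ closure Ω) := by
    refine ContinuousOn.div ?_ ?_ ?_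
    · exact (hwc.comp continuousOn_snd fun p hp => hp.2).sub (hwc.comp continuousOn_fst fun p hp => hp.1)
    · intro p hp
      have := (hη _ (hIK _ hp.1 _ hp.2)).continuousAt
      exact (ContinuousAt.comp (f := fun p : F × F => ‖p.2 - p.1‖ / 2) this (by fun_prop)).continuousWithinAt
    · intro p hp
      exact (hηp _ hp.1 _ hp.2).ne'
  obtain ⟨⟨x, y⟩, hp, hmx⟩ := hcK.exists_isMaxOn ⟨(x0, y0), hx0, hy0⟩ hc
  obtain ⟨hx, hy⟩ : x ∈ closure Ω ∧ y ∈ closure Ω := hp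
  set m := (w y - w x) / η (‖y - x‖ / 2) with hm
  have hmpos : 0 < m := by
    have h1 : (w y0 - w x0) / η (‖y0 - x0‖ / 2) ≤ m := hmx (show (x0, y0) ∈ _ from ⟨hx0, hy0⟩)
    refine lt_of_lt_of_le ?_ h1
    exact div_pos (by linarith) (hηp _ hx0 _ hy0)
  have hle : ∀ x' ∈ closure Ω, ∀ y' ∈ closure Ω, w y' - w x' ≤ m * η (‖y' - x'‖ / 2) := by
    intro x' hx' y' hy'
    have h1 : (w y' - w x') / η (‖y' - x'‖ / 2) ≤ m := hmx (show (x', y') ∈ _ from ⟨hx', hy'⟩)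
    rwa [div_le_iff₀ (hηp _ hx' _ hy')] at h1
  have h0 : w y - w x = m * η (‖y - x‖ / 2) := by
    rw [hm, div_mul_cancel₀ _ (hηp _ hx _ hy).ne']
  clear_value m
  have hxy : x ≠ y := by
    rintro rfl
    have := hηp _ hx _ hx
    have : 0 < m * η (‖x - x‖ / 2) := by positivity
    linarith
  have hηd := hη _ (hIK _ hx _ hy)
  have hmaxy : ∀ z ∈ closure Ω, w z - m * η (‖z - x‖ / 2) ≤ w y - m * η (‖y - x‖ / 2) := by
    intro z hz
    have := hle x hx z hz
    linarith
  have hmaxx : ∀ z ∈ closure Ω, (-w) z - m * η (‖z - y‖ / 2) ≤ (-w) x - m * η (‖x - y‖ / 2) := by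
    intro z hz
    have := hle z hz y hy
    rw [norm_sub_rev z y, norm_sub_rev x y]
    simp only [Pi.neg_apply]
    linarith
  have hyΩ : y ∈ Ω := by
    rcases g.mem_or hy with h1 | h1
    · exact h1
    · exact (bdry_contra g h1 hx hxy (h.d1 y hy) (hν y h1) hηd (hηposq _ hx _ hy) hmpos hmaxy).elim
  have hxΩ : x ∈ Ω := by
    rcases g.mem_or hx with h1 | h1
    · exact h1
    · exact (bdry_contra g h1 hy hxy.symm (h.d1 x hx).neg (by simp [hν x h1])
        (show HasDerivAt η (η1 (‖y - x‖ / 2)) (‖x - y‖ / 2) by rw [norm_sub_rev x y]; exact hηd) (hηposq _ hx _ hy) hmpos hmaxx).elim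
  have hw : y - x ≠ 0 := sub_ne_zero.2 hxy.symm
  obtain ⟨d, hd⟩ : ∃ d, d = ‖y - x‖ := ⟨_, rfl⟩
  have hd0 : 0 < d := by rw [hd]; exact norm_pos_iff.2 hw
  obtain ⟨e, he_def⟩ : ∃ e : F, e = d⁻¹ • (y - x) := ⟨_, rfl⟩
  have he : ‖e‖ = 1 := by
    rw [he_def, norm_smul, norm_inv, Real.norm_of_nonneg hd0.le, ← hd, inv_mul_cancel₀ hd0.ne']
  have hyx : y - x = d • e := by rw [he_def, smul_smul, mul_inv_cancel₀ hd0.ne', one_smul]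
  have hdI : d / 2 ∈ I := by rw [hd]; exact hIK _ hx _ hy
  have fy := fo_w ho hyΩ hd0 he hyx (h.at1 ho hyΩ) (hη _ hdI) (fun z hz => hmaxy z (subset_closure hz))
  have fx := fo_w ho (w := -w) (e := -e) hxΩ hd0 (by rw [norm_neg, he])
    (by rw [smul_neg, ← hyx]; abel) (h.at1 ho hxΩ).neg (hη _ hdI) (fun z hz => hmaxx z (subset_closure hz))
  have hso := so_w ho (fun z hz => h.at1 ho hz) (fun z hz => h.at2 ho hz) hxΩ hyΩ hd0 he hyx
    (by filter_upwards [hI.mem_nhds hdI] with z hz using hη z hz) (hη1 _ hdI)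
    (fun x' hx' y' hy' => hle x' (subset_closure hx') y' (subset_closure hy')) (by rw [hd]; exact h0)
  have hsum := Finset.sum_le_sum (s := Finset.univ) (fun i _ => hso (b i))
  simp only [Finset.sum_sub_distrib, Finset.sum_const_zero, ← Finset.mul_sum] at hsum
  rw [trace_refl b he, basis_inner_sq b he] at hsum
  have hey := heq y hyΩ
  have hex := heq x hxΩ
  have sy : ∑ i, U1 y (b i) * w1 y (b i) = m * η1 (d / 2) / 2 * U1 y e := by
    rw [← basis_expand b e (U1 y), Finset.mul_sum]
    exact Finset.sum_congr rfl fun i _ => by rw [fy]; ring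
  have sx : ∑ i, U1 x (b i) * w1 x (b i) = m * η1 (d / 2) / 2 * U1 x e := by
    rw [← basis_expand b e (U1 x), Finset.mul_sum]
    refine Finset.sum_congr rfl fun i _ => ?_
    have := fx (b i)
    simp only [neg_apply, inner_neg_left] at this
    have h2 : w1 x (b i) = m * η1 (d / 2) / 2 * ⟪e, b i⟫ := by linarith
    rw [h2]; ring
  rw [sy] at hey
  rw [sx] at hex
  have hz := hZ x hxΩ y hyΩ hxy
  simp only [Zf] at hz
  rw [← hd, hyx, map_smul, smul_eq_mul, mul_div_cancel_left₀ _ hd0.ne', sub_apply] at hz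
  rw [← hd] at h0
  have hp1 : 0 < η1 (d / 2) := by rw [hd]; exact hηposq _ hx _ hy
  have hp0 : 0 < η (d / 2) := by rw [hd]; exact hηp _ hx _ hy
  have hod := hode _ hdI
  have k1 : m * η1 (d / 2) * (U1 y e - U1 x e - 2 * ψ (d / 2)) ≤ 0 :=
    mul_nonpos_of_nonneg_of_nonpos (by positivity) hz
  have k2 : κ * (m * η (d / 2)) ≤ μ * (m * η (d / 2)) := by
    have e1 : μ * (m * η (d / 2)) = μ * w y - μ * w x := by rw [← h0]; ring
    have e2 : m * (η2 (d / 2) + 2 * ψ (d / 2) * η1 (d / 2) + κ * η (d / 2)) = 0 := by rw [hod, mul_zero]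
    rw [e1]
    linarith
  exact le_of_mul_le_mul_right k2 (by positivity)
end


section
set_option linter.unusedSectionVars false
set_option maxSynthPendingDepth 3
open Filter Topology
variable {F : Type*} [NormedAddCommGroup F] [InnerProductSpace ℝ F] [FiniteDimensional ℝ F]
variable {ι : Type*} [Fintype ι]

lemma hda_lin (a z : ℝ) : HasStrictDerivAt (fun z : ℝ => a * z) a z := by
  simpa using (hasStrictDerivAt_id z).const_mul a

lemma hda_cos (a z : ℝ) : HasStrictDerivAt (fun z : ℝ => Real.cos (a * z)) (-Real.sin (a * z) * a) z :=
  HasStrictDerivAt.comp z (Real.hasStrictDerivAt_cos (a * z)) (hda_lin a z)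

lemma hda_sin (a z : ℝ) : HasStrictDerivAt (fun z : ℝ => Real.sin (a * z)) (Real.cos (a * z) * a) z :=
  HasStrictDerivAt.comp z (Real.hasStrictDerivAt_sin (a * z)) (hda_lin a z)

lemma cos_pos_T {a : ℝ} (ha : 0 < a) {z : ℝ} (hz : z ∈ Ioo (-(Real.pi / (2 * a))) (Real.pi / (2 * a))) :
    0 < Real.cos (a * z) := by
  apply Real.cos_pos_of_mem_Ioo
  have h1 : a * (Real.pi / (2 * a)) = Real.pi / 2 := by field_simp
  constructor
  · have := mul_lt_mul_of_pos_left hz.1 ha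
    rw [mul_neg, h1] at this
    linarith
  · have := mul_lt_mul_of_pos_left hz.2 ha
    rw [h1] at this
    exact this

lemma psi_trig {a : ℝ} (ha : 0 < a) : Psi (Real.pi / (2 * a)) (fun z => Real.log (Real.cos (a * z)))
    (fun z => -a * (Real.sin (a * z) / Real.cos (a * z)))
    (fun z => -a ^ 2 * (Real.cos (a * z) ^ 2)⁻¹)
    (fun z => -2 * a ^ 3 * (Real.sin (a * z) / Real.cos (a * z) ^ 3)) where
  pos := by have := Real.pi_pos; positivity
  dG := by
    intro z hz
    have hc := cos_pos_T ha hz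
    refine ((hda_cos a z).hasDerivAt.log hc.ne').congr_deriv ?_
    ring
  dψ := by
    intro z hz
    have hc := cos_pos_T ha hz
    refine (((hda_sin a z).hasDerivAt.div (hda_cos a z).hasDerivAt hc.ne').const_mul (-a)).congr_deriv ?_
    have := Real.sin_sq_add_cos_sq (a * z)
    have e : Real.cos (a * z) * a * Real.cos (a * z) - Real.sin (a * z) * (-Real.sin (a * z) * a) = a := by
      linear_combination a * this
    rw [e]
    ring
  dψ1 := by
    intro z hz
    have hc := cos_pos_T ha hz
    have h1 : HasStrictDerivAt (fun z : ℝ => (Real.cos (a * z) ^ 2)⁻¹)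
        (-((Real.cos (a * z) ^ 2) ^ 2)⁻¹ * (2 * Real.cos (a * z) * (-Real.sin (a * z) * a))) z := by
      have h2 : HasStrictDerivAt (fun z : ℝ => Real.cos (a * z) ^ 2) (2 * Real.cos (a * z) * (-Real.sin (a * z) * a)) z := by
        have := (hda_cos a z).mul (hda_cos a z)
        have e : (fun z : ℝ => Real.cos (a * z) ^ 2) = (fun z : ℝ => Real.cos (a * z)) * (fun z : ℝ => Real.cos (a * z)) := by
          funext z; simp [sq]
        rw [e]
        refine this.congr_deriv ?_
        ring
      exact HasStrictDerivAt.comp z (hasStrictDerivAt_inv (by positivity)) h2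
    refine (h1.const_mul (-a ^ 2)).congr_deriv ?_
    field_simp
  ode := by
    intro z hz
    have hc := cos_pos_T ha hz
    field_simp
    ring
  neg := by
    intro z hz
    have hc := cos_pos_T ha hz
    have : 0 < a ^ 2 * (Real.cos (a * z) ^ 2)⁻¹ := by positivity
    linarith
  zero := by simp

noncomputable def eta0 (a ε z : ℝ) : ℝ :=
  Real.sin (a * z) + ε * (2 * Real.cos (a * z) - (Real.cos (a * z))⁻¹)
noncomputable def eta1 (a ε z : ℝ) : ℝ :=
  a * Real.cos (a * z) - ε * (2 * a * Real.sin (a * z) + a * (Real.sin (a * z) * (Real.cos (a * z) ^ 2)⁻¹))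
noncomputable def eta2 (a ε z : ℝ) : ℝ :=
  - a ^ 2 * Real.sin (a * z) - ε * (2 * a ^ 2 * Real.cos (a * z)
    + a ^ 2 * ((Real.cos (a * z) ^ 2 + 2 * Real.sin (a * z) ^ 2) / Real.cos (a * z) ^ 3))

lemma eta0_deriv {a : ℝ} (ε : ℝ) {z : ℝ} (hc : 0 < Real.cos (a * z)) :
    HasDerivAt (eta0 a ε) (eta1 a ε z) z := by
  have h1 := (hda_sin a z).hasDerivAt
  have h2 := (hda_cos a z).hasDerivAt
  have h3 : HasDerivAt (fun z : ℝ => (Real.cos (a * z))⁻¹) _ z := h2.fun_inv hc.ne'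
  refine (h1.add (((h2.const_mul 2).sub h3).const_mul ε)).congr_deriv ?_
  simp only [eta1]
  field_simp
  ring

lemma eta1_deriv {a : ℝ} (ε : ℝ) {z : ℝ} (hc : 0 < Real.cos (a * z)) :
    HasDerivAt (eta1 a ε) (eta2 a ε z) z := by
  have h1 := (hda_sin a z).hasDerivAt
  have h2 := (hda_cos a z).hasDerivAt
  have h3 : HasDerivAt (fun z : ℝ => (Real.cos (a * z) ^ 2)⁻¹) _ z := (h2.fun_pow 2).fun_inv (by positivity)
  refine ((h2.const_mul a).sub (((h1.const_mul (2 * a)).add ((h1.mul h3).const_mul a)).const_mul ε)).congr_deriv ?_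
  simp only [eta2]
  field_simp
  ring

lemma eta_ode {a : ℝ} (ε : ℝ) {z : ℝ} (hc : 0 < Real.cos (a * z)) :
    eta2 a ε z + 2 * (-a * (Real.sin (a * z) / Real.cos (a * z))) * eta1 a ε z
      + 3 * a ^ 2 * eta0 a ε z = 0 := by
  have hs : Real.sin (a * z) ^ 2 = 1 - Real.cos (a * z) ^ 2 := by
    have := Real.sin_sq_add_cos_sq (a * z); linarith
  simp only [eta0, eta1, eta2]
  field_simp
  ring_nf
  simp only [hs]
  ring

lemma eta_pos {a β : ℝ} (ha : 0 < a) (hβ : β < Real.pi / 2) (hβ0 : 0 ≤ β) {z : ℝ} (hz : 0 ≤ z)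
    (hzβ : a * z ≤ β) : 0 < eta0 a (Real.cos β ^ 3 / 4) z ∧ 0 < eta1 a (Real.cos β ^ 3 / 4) z := by
  have hpi := Real.pi_pos
  have hc0 : 0 < Real.cos β := Real.cos_pos_of_mem_Ioo ⟨by linarith, hβ⟩
  have haz : 0 ≤ a * z := by positivity
  have hcc : Real.cos β ≤ Real.cos (a * z) :=
    Real.cos_le_cos_of_nonneg_of_le_pi haz (by linarith) hzβ
  have hs0 : 0 ≤ Real.sin (a * z) := Real.sin_nonneg_of_nonneg_of_le_pi haz (by linarith)
  have hs1 := Real.sin_le_one (a * z)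
  have hc1 := Real.cos_le_one β
  have hs := Real.sin_sq_add_cos_sq (a * z)
  simp only [eta0, eta1]
  generalize Real.cos β = C at *
  generalize Real.cos (a * z) = c at *
  generalize Real.sin (a * z) = s at *
  have hc : 0 < c := hc0.trans_le hcc
  have hC3 : 0 < C ^ 3 := by positivity
  have hC2 : C ^ 2 ≤ 1 := by nlinarith
  have hCc : C ^ 3 * c⁻¹ ≤ C ^ 2 := by
    rw [← div_eq_mul_inv, div_le_iff₀ hc]
    nlinarith [sq_nonneg C, mul_le_mul_of_nonneg_left hcc (sq_nonneg C)]
  constructor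
  · have e : s + C ^ 3 / 4 * (2 * c - c⁻¹) = s * (1 - s * (C ^ 3 * c⁻¹) / 4) + C ^ 3 / 4 * c := by
      have e2 : c⁻¹ = c + s ^ 2 * c⁻¹ := by field_simp; linarith
      have : 2 * c - c⁻¹ = c - s ^ 2 * c⁻¹ := by linarith
      rw [this]; ring
    rw [e]
    have h0 : 0 ≤ C ^ 3 * c⁻¹ := by positivity
    have h1 : s * (C ^ 3 * c⁻¹) ≤ 1 := by nlinarith
    have h2 : 0 ≤ s * (1 - s * (C ^ 3 * c⁻¹) / 4) := mul_nonneg hs0 (by linarith)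
    have h3 : 0 < C ^ 3 / 4 * c := by positivity
    linarith
  · have hq : C ^ 3 * (c ^ 2)⁻¹ ≤ C := by
      rw [← div_eq_mul_inv, div_le_iff₀ (by positivity)]
      have : C ^ 2 ≤ c ^ 2 := by gcongr
      nlinarith
    have h0 : 0 ≤ C ^ 3 * (c ^ 2)⁻¹ := by positivity
    have h1 : s * (C ^ 3 * (c ^ 2)⁻¹) ≤ C := by nlinarith
    have h2 : s * C ^ 3 ≤ C := by nlinarith
    have e : a * c - C ^ 3 / 4 * (2 * a * s + a * (s * (c ^ 2)⁻¹))
      = a * (c - (s * C ^ 3) / 2 - (s * (C ^ 3 * (c ^ 2)⁻¹)) / 4) := by ring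
    rw [e]
    apply mul_pos ha
    linarith

lemma TwoD.of_cd {K : Set F} (hu : UniqueDiffOn ℝ K) {f : F → ℝ} (hf : ContDiffOn ℝ 2 f K) :
    TwoD K f (fderivWithin ℝ f K) (fderivWithin ℝ (fderivWithin ℝ f K) K) := by
  have h1 : ContDiffOn ℝ 1 (fderivWithin ℝ f K) K := hf.fderivWithin hu (by norm_num)
  exact ⟨fun x hx => (hf.differentiableOn (by norm_num) x hx).hasFDerivWithinAt,
    fun x hx => (h1.differentiableOn (by norm_num) x hx).hasFDerivWithinAt,
    h1.continuousOn_fderivWithin hu (by norm_num)⟩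

lemma lap_eq {n : ℕ} {Ω : Set (EuclideanSpace ℝ (Fin n))} (ho : IsOpen Ω)
    {f : EuclideanSpace ℝ (Fin n) → ℝ} {P} {Q} (h : TwoD (closure Ω) f P Q)
    {x : EuclideanSpace ℝ (Fin n)} (hx : x ∈ Ω) :
    lap f x = ∑ i, Q x (EuclideanSpace.basisFun (Fin n) ℝ i) (EuclideanSpace.basisFun (Fin n) ℝ i) := by
  unfold lap
  refine Finset.sum_congr rfl fun i _ => ?_
  simp only [EuclideanSpace.basisFun_apply]
  generalize EuclideanSpace.single i (1:ℝ) = v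
  have e1 : (fun y => fderiv ℝ f y v) =ᶠ[𝓝 x] fun y => P y v := by
    filter_upwards [ho.mem_nhds hx] with y hy
    rw [(h.at1 ho hy).fderiv]
  rw [e1.fderiv_eq]
  have := (h.at2 ho hx).clm_apply (hasFDerivAt_const v x)
  rw [this.fderiv]
  simp

lemma quot_eq (b : OrthonormalBasis ι ℝ F) {Ω : Set F} (ho : IsOpen Ω)
    {φ φ' w : F → ℝ} {P P' W1 : F → F →L[ℝ] ℝ} {Q Q' W2 : F → F →L[ℝ] F →L[ℝ] ℝ}
    (h : TwoD (closure Ω) φ P Q) (h' : TwoD (closure Ω) φ' P' Q') (hw : TwoD (closure Ω) w W1 W2)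
    (hpos : ∀ x ∈ Ω, 0 < φ x) (hq : ∀ x ∈ Ω, w x = φ' x / φ x) {q : F → ℝ} {l l' : ℝ}
    (heq : ∀ x ∈ Ω, ∑ i, Q x (b i) (b i) - q x * φ x = - l * φ x)
    (heq' : ∀ x ∈ Ω, ∑ i, Q' x (b i) (b i) - q x * φ' x = - l' * φ' x) {x : F} (hx : x ∈ Ω) :
    ∑ i, W2 x (b i) (b i) + 2 * ∑ i, UU1 φ P x (b i) * W1 x (b i) = - (l' - l) * w x := by
  have hmul : ∀ z ∈ Ω, φ' z = w z * φ z := fun z hz => by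
    rw [hq z hz, div_mul_cancel₀ _ (hpos z hz).ne']
  have hP' : ∀ z ∈ Ω, P' z = w z • P z + φ z • W1 z := by
    intro z hz
    have h1 := (hw.at1 ho hz).mul (h.at1 ho hz)
    refine (h'.at1 ho hz).unique (h1.congr_of_eventuallyEq ?_)
    filter_upwards [ho.mem_nhds hz] with y hy using hmul y hy
  have hQ' : ∀ v, Q' x v v = w x * Q x v v + 2 * (P x v * W1 x v) + φ x * W2 x v v := by
    intro v
    have h1 := ((hw.at1 ho hx).smul (h.at2 ho hx)).add ((h.at1 ho hx).smul (hw.at2 ho hx))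
    have h2 := (h'.at2 ho hx).unique (h1.congr_of_eventuallyEq (by
      filter_upwards [ho.mem_nhds hx] with y hy using hP' y hy))
    rw [h2]
    simp
    ring
  have e1 := heq x hx
  have e2 := heq' x hx
  have hp := hpos x hx
  simp only [hQ', Finset.sum_add_distrib, ← Finset.mul_sum] at e2
  rw [hmul x hx] at e2
  have e3 : ∑ i, UU1 φ P x (b i) * W1 x (b i) = (φ x)⁻¹ * ∑ i, P x (b i) * W1 x (b i) := by
    rw [Finset.mul_sum]
    exact Finset.sum_congr rfl fun i _ => by simp [UU1, mul_assoc]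
  rw [e3]
  have e4 : ∑ i, Q x (b i) (b i) = (q x - l) * φ x := by linarith
  rw [e4] at e2
  generalize ∑ i, P x (b i) * W1 x (b i) = A at *
  generalize ∑ i, W2 x (b i) (b i) = B at *
  have e5 : 2 * A + φ x * B = - (l' - l) * w x * φ x := by linear_combination e2
  field_simp
  linarith

lemma convex_mono {Ω : Set F} {q : F → ℝ} {q1 : F → F →L[ℝ] ℝ} (hq : ConvexOn ℝ Ω q)
    (hd : ∀ x ∈ Ω, HasFDerivAt q (q1 x) x) {x y : F} (hx : x ∈ Ω) (hy : y ∈ Ω) :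
    0 ≤ (q1 y - q1 x) (y - x) := by
  have key : ∀ x ∈ Ω, ∀ y ∈ Ω, q1 x (y - x) ≤ q y - q x := by
    intro x hx y hy
    have h1 : HasDerivAt (fun t : ℝ => q (x + t • (y - x))) (q1 x (y - x)) 0 :=
      HasFDerivAt.comp_hasDerivAt (0:ℝ) (by simpa using hd x hx) (hasDerivAt_line x (y - x) 0)
    have h2 := (hasDerivAt_iff_tendsto_slope.1 h1).mono_left
      (nhdsWithin_mono _ (fun t (ht : t ∈ Ioi (0:ℝ)) => ne_of_gt ht))
    refine le_of_tendsto h2 ?_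
    filter_upwards [Ioc_mem_nhdsGT (show (0:ℝ) < 1 by norm_num)] with t ht
    rw [slope_def_field]
    simp only [zero_smul, add_zero, sub_zero]
    rw [div_le_iff₀ ht.1]
    have := hq.2 hx hy (sub_nonneg.2 ht.2) ht.1.le (by ring)
    have e : (1 - t) • x + t • y = x + t • (y - x) := by module
    rw [e] at this
    simp only [smul_eq_mul] at this
    linarith
  have h1 := key x hx y hy
  have h2 := key y hy x hx
  rw [← neg_sub, map_neg] at h2
  rw [sub_apply]
  linarith

end

theorem stmt_7 {n : ℕ}
    (Ω : Set (EuclideanSpace ℝ (Fin n))) (ρ : EuclideanSpace ℝ (Fin n) → ℝ)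
    (hΩ : IsOpen Ω) (hbd : Bornology.IsBounded Ω)
    (hρ : ContDiff ℝ 2 ρ)
    (hΩρ : Ω = {x | ρ x < 0})
    (hfr : frontier Ω = {x | ρ x = 0})
    (hν : ∀ x ∈ frontier Ω, gradient ρ x ≠ 0)
    (hsc : ∀ x ∈ frontier Ω, ∀ v : EuclideanSpace ℝ (Fin n), v ≠ 0 → ⟪gradient ρ x, v⟫ = 0 →
      0 < fderiv ℝ (fun y => fderiv ℝ ρ y v) x v)
    (D : ℝ) (hD : Metric.diam Ω = D)
    (q : EuclideanSpace ℝ (Fin n) → ℝ)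
    (hq : ConvexOn ℝ (closure Ω) q) (hqC : ContDiffOn ℝ 1 q (closure Ω))
    (φ₀ : EuclideanSpace ℝ (Fin n) → ℝ) (lam0 : ℝ)
    (hφC : ContDiffOn ℝ 2 φ₀ (closure Ω))
    (hφpos : ∀ x ∈ Ω, 0 < φ₀ x)
    (hφbd : ∀ x ∈ frontier Ω, φ₀ x = 0)
    (hφν : ∀ x ∈ frontier Ω, fderivWithin ℝ φ₀ (closure Ω) x (gradient ρ x) < 0)
    (heig : ∀ x ∈ Ω, lap φ₀ x - q x * φ₀ x = -lam0 * φ₀ x)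
    (φ₁ : EuclideanSpace ℝ (Fin n) → ℝ) (lam1 : ℝ) (w : EuclideanSpace ℝ (Fin n) → ℝ)
    (hφ₁C : ContDiffOn ℝ 2 φ₁ (closure Ω))
    (hφ₁bd : ∀ x ∈ frontier Ω, φ₁ x = 0)
    (hφ₁ne : ∃ x ∈ closure Ω, φ₁ x ≠ 0)
    (heig1 : ∀ x ∈ Ω, lap φ₁ x - q x * φ₁ x = -lam1 * φ₁ x)
    (hwC : ContDiffOn ℝ 2 w (closure Ω))
    (hw : ∀ x ∈ Ω, w x = φ₁ x / φ₀ x)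
    (hwnc : ¬ ∃ c : ℝ, ∀ x ∈ closure Ω, w x = c)
    (hwν : ∀ x ∈ frontier Ω, fderivWithin ℝ w (closure Ω) x (gradient ρ x) = 0)
 :
    3 * Real.pi ^ 2 / D ^ 2 ≤ lam1 - lam0 := by
  have g : Geo Ω ρ := by
    refine ⟨hΩ, hbd, hρ, hΩρ, hfr, hν, ?_, hq.1⟩
    intro x hx v hv hv0
    have h1 := hsc x hx v hv (by rw [inner_gradient_left]; exact hv0)
    have hd : Differentiable ℝ (fderiv ℝ ρ) :=
      (hρ.fderiv_right (m := 1) (by norm_num)).differentiable (by norm_num)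
    have h2 := (hd x).hasFDerivAt.clm_apply (hasFDerivAt_const v x)
    rw [h2.fderiv] at h1
    simpa using h1
  obtain ⟨y0, hy0, z0, hz0, hyz⟩ : ∃ x ∈ closure Ω, ∃ y ∈ closure Ω, w x < w y := by
    by_contra hcon
    push Not at hcon
    apply hwnc
    rcases (closure Ω).eq_empty_or_nonempty with h | ⟨x0, hx0⟩
    · exact ⟨0, fun x hx => by rw [h] at hx; exact hx.elim⟩
    · exact ⟨w x0, fun x hx => le_antisymm (hcon x0 hx0 x hx) (hcon x hx x0 hx0)⟩
  have hne : Ω.Nonempty := closure_nonempty_iff.1 ⟨y0, hy0⟩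
  have hu : UniqueDiffOn ℝ (closure Ω) := uniqueDiffOn_convex g.conv (by rw [g.interior_eq]; exact hne)
  have h0 := TwoD.of_cd hu hφC
  have h1 := TwoD.of_cd hu hφ₁C
  have h2 := TwoD.of_cd hu hwC
  set b := EuclideanSpace.basisFun (Fin n) ℝ with hb
  have hdist : ∀ x ∈ closure Ω, ∀ y ∈ closure Ω, ‖y - x‖ ≤ D := by
    intro x hx y hy
    rw [← dist_eq_norm, ← hD, ← Metric.diam_closure]
    exact Metric.dist_le_diam_of_mem hbd.closure hy hx
  have hD0 : 0 ≤ D := by rw [← hD]; exact Metric.diam_nonneg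
  have hqs : ∀ x ∈ Ω, HasStrictFDerivAt q (fderiv ℝ q x) x := fun x hx =>
    (hqC.contDiffAt (Filter.mem_of_superset (hΩ.mem_nhds hx) subset_closure)).hasStrictFDerivAt (by norm_num)
  have hqm : ∀ x ∈ Ω, ∀ y ∈ Ω, 0 ≤ (fderiv ℝ q y - fderiv ℝ q x) (y - x) := fun x hx y hy =>
    convex_mono (hq.subset subset_closure g.convΩ) (fun z hz => (hqs z hz).hasFDerivAt) hx hy
  have e0 : ∀ x ∈ Ω, ∑ i, fderivWithin ℝ (fderivWithin ℝ φ₀ (closure Ω)) (closure Ω) x (b i) (b i)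
      - q x * φ₀ x = - lam0 * φ₀ x := fun x hx => by rw [← lap_eq hΩ h0 hx]; exact heig x hx
  have e1 : ∀ x ∈ Ω, ∑ i, fderivWithin ℝ (fderivWithin ℝ φ₁ (closure Ω)) (closure Ω) x (b i) (b i)
      - q x * φ₁ x = - lam1 * φ₁ x := fun x hx => by rw [← lap_eq hΩ h1 hx]; exact heig1 x hx
  have main : ∀ a : ℝ, 0 < a → a * D < Real.pi → 3 * a ^ 2 ≤ lam1 - lam0 := by
    intro a ha haD
    have hpi := Real.pi_pos
    have hT : ∀ x ∈ closure Ω, ∀ y ∈ closure Ω, ‖y - x‖ / 2 < Real.pi / (2 * a) := by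
      intro x hx y hy
      have := hdist x hx y hy
      rw [div_lt_div_iff₀ (by norm_num) (by positivity)]
      nlinarith
    have hIoo : ∀ x ∈ closure Ω, ∀ y ∈ closure Ω,
        ‖y - x‖ / 2 ∈ Ioo (-(Real.pi / (2 * a))) (Real.pi / (2 * a)) := fun x hx y hy =>
      ⟨by have := norm_nonneg (y - x)
          have : 0 < Real.pi / (2 * a) := by positivity
          linarith, hT x hx y hy⟩
    have hβ0 : 0 ≤ a * D / 2 := by positivity
    have hp : ∀ x ∈ closure Ω, ∀ y ∈ closure Ω, _ := fun x hx y hy =>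
      eta_pos (β := a * D / 2) ha (by linarith) hβ0 (z := ‖y - x‖ / 2) (by positivity)
        (by have := mul_le_mul_of_nonneg_left (hdist x hx y hy) ha.le; linarith)
    refine gap_bound b g h2 hwν (U1 := UU1 φ₀ (fderivWithin ℝ φ₀ (closure Ω)))
      (fun x hx y hy hxy => Z_le b g h0 hφpos hφbd hφν hqs hqm e0 (psi_trig ha) hT hx hy hxy)
      (fun x hx => quot_eq b hΩ h0 h1 h2 hφpos hw e0 e1 hx) ⟨y0, hy0, z0, hz0, hyz⟩
      isOpen_Ioo hIoo (fun z hz => eta0_deriv _ (cos_pos_T ha hz))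
      (fun z hz => eta1_deriv _ (cos_pos_T ha hz))
      (fun x hx y hy => (hp x hx y hy).1) (fun x hx y hy => (hp x hx y hy).2)
      (fun z hz => eta_ode _ (cos_pos_T ha hz))
  rcases hD0.eq_or_lt with hD' | hD'
  · have := main 1 one_pos (by rw [← hD']; simpa using Real.pi_pos)
    rw [← hD']
    norm_num
    linarith
  · have hpi := Real.pi_pos
    have ht : Filter.Tendsto (fun a : ℝ => 3 * a ^ 2) (nhdsWithin (Real.pi / D) (Iio (Real.pi / D)))
        (nhds (3 * (Real.pi / D) ^ 2)) := by
      have : Continuous (fun a : ℝ => 3 * a ^ 2) := by fun_prop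
      exact (this.tendsto _).mono_left nhdsWithin_le_nhds
    have hfin : 3 * (Real.pi / D) ^ 2 ≤ lam1 - lam0 := by
      refine le_of_tendsto ht ?_
      filter_upwards [Ioo_mem_nhdsLT (show 0 < Real.pi / D by positivity)] with a ha
      exact main a ha.1 ((lt_div_iff₀ hD').1 ha.2)
    rw [div_pow] at hfin
    rw [mul_div_assoc]
    exact hfin
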